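/- arXiv:math/0303066 — 2 statements merged into one kernel-verified Lean document; each statement's English description precedes it below -/
import Mathlib

section
/- (Apéry) The number ζ(3) = Σ_{n≥1} 1/n³ is irrational. -/
/-- The values of the Riemann zeta function at integers `s ≥ 2`,
as a real number: `ζ(s) = ∑_{n ≥ 1} n^{-s}`. -/
noncomputable def zetaR (s : ℕ) : ℝ := ∑' n : ℕ, 1 / (n + 1 : ℝ) ^ s

open Finset Filter Topology
open Nat (lcmUpto)
open scoped Nat

theorem lcmUpto_mul_factorials_dvd {m : ℕ} (hm : m ≠ 0) :
    lcmUpto (42 * m) * ((21 * m)! * (14 * m)! * (6 * m)! * m !) ∣ lcmUpto m * (42 * m)! := by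
  have h0 := Nat.lcmUpto_ne_zero
  have hf := Nat.factorial_ne_zero
  rw [← Nat.factorization_prime_le_iff_dvd (by simp [h0, hf]) (by simp [h0, hf])]
  intro p hp
  have key : ∀ i ∈ Ico 1 (p.log (42 * m) + 1),
      1 + (21 * m / p ^ i + 14 * m / p ^ i + 6 * m / p ^ i + m / p ^ i) ≤
        (if i ≤ p.log m then 1 else 0) + 42 * m / p ^ i := by
    intro i hi
    rw [mem_Ico] at hi
    have hq : 0 < p ^ i := pow_pos hp.pos _
    have e1 : 21 * m / p ^ i = 42 * m / p ^ i / 2 := by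
      rw [Nat.div_div_eq_div_mul, mul_comm (p ^ i), ← Nat.div_div_eq_div_mul]; congr 1; omega
    have e2 : 14 * m / p ^ i = 42 * m / p ^ i / 3 := by
      rw [Nat.div_div_eq_div_mul, mul_comm (p ^ i), ← Nat.div_div_eq_div_mul]; congr 1; omega
    have e3 : 6 * m / p ^ i = 42 * m / p ^ i / 7 := by
      rw [Nat.div_div_eq_div_mul, mul_comm (p ^ i), ← Nat.div_div_eq_div_mul]; congr 1; omega
    have e4 : m / p ^ i = 42 * m / p ^ i / 42 := by
      rw [Nat.div_div_eq_div_mul, mul_comm (p ^ i), ← Nat.div_div_eq_div_mul]; congr 1; omega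
    have hpos : 1 ≤ 42 * m / p ^ i := by
      rw [Nat.one_le_div_iff hq]
      exact Nat.pow_le_of_le_log (by omega) (by omega)
    split_ifs with h
    · omega
    · have : m / p ^ i = 0 := Nat.div_eq_of_lt (Nat.lt_pow_of_log_lt hp.one_lt (by omega))
      omega
  have hlog (j : ℕ) (hj : j ≤ 42 * m) : p.log j < p.log (42 * m) + 1 :=
    Nat.lt_succ_of_le (Nat.log_mono_right hj)
  have hsum := Finset.sum_le_sum key
  have hcard : ∑ i ∈ Ico 1 (p.log (42 * m) + 1), (if i ≤ p.log m then 1 else 0) ≤ p.log m := by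
    rw [Finset.sum_boole, Nat.cast_id]
    refine (card_le_card (t := Icc 1 (p.log m)) fun i hi => ?_).trans (by simp)
    simp only [mem_filter, mem_Ico, mem_Icc] at hi ⊢
    omega
  simp only [sum_add_distrib] at hsum
  rw [Finset.sum_const, Nat.card_Ico] at hsum
  simp only [Nat.factorization_mul, h0, hf, ne_eq, not_false_eq_true,
    mul_eq_zero, or_self, Finsupp.add_apply, Nat.factorization_lcmUpto _ hp]
  rw [Nat.factorization_factorial hp (hlog (42 * m) le_rfl),
    Nat.factorization_factorial hp (hlog (21 * m) (by omega)),
    Nat.factorization_factorial hp (hlog (14 * m) (by omega)),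
    Nat.factorization_factorial hp (hlog (6 * m) (by omega)),
    Nat.factorization_factorial hp (hlog m (by omega))]
  simp only [smul_eq_mul, mul_one] at hsum
  omega

theorem choose_mul_pow_le (a b x : ℕ) : (a + b).choose b * x ^ a ≤ (x + 1) ^ (a + b) := by
  rw [add_pow]
  refine le_trans (le_of_eq ?_) (single_le_sum (f := fun k => x ^ k * 1 ^ (a + b - k) *
    ((a + b).choose k)) (a := a) (fun _ _ => Nat.zero_le _) (mem_range.2 (by omega : a < a + b + 1)))
  rw [← Nat.choose_symm_add, one_pow, mul_one, mul_comm]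

theorem lcmUpto_mul_le {m : ℕ} (hm : m ≠ 0) :
    lcmUpto (42 * m) ≤ lcmUpto m * (2 ^ 22 * 3 ^ 15 * 7 ^ 7) ^ m := by
  have h1 := choose_mul_pow_le (21 * m) (21 * m) 1
  have h2 := choose_mul_pow_le (14 * m) (7 * m) 2
  have h3 := choose_mul_pow_le (6 * m) m 6
  have f1 := Nat.add_choose_mul_factorial_mul_factorial (21 * m) (21 * m)
  have f2 := Nat.add_choose_mul_factorial_mul_factorial (14 * m) (7 * m)
  have f3 := Nat.add_choose_mul_factorial_mul_factorial (6 * m) m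
  rw [show 21 * m + 21 * m = 42 * m by ring] at h1 f1
  rw [show 14 * m + 7 * m = 21 * m by ring] at h2 f2
  rw [show 6 * m + m = 7 * m by ring] at h3 f3
  have hd := Nat.le_of_dvd (by have := Nat.lcmUpto_pos m; positivity) (lcmUpto_mul_factorials_dvd hm)
  set A := (42 * m).choose (21 * m)
  set B := (21 * m).choose (7 * m)
  set C := (7 * m).choose m
  set F := (21 * m)! * (14 * m)! * (6 * m)! * m ! with hF
  have hfac : (42 * m)! = A * B * C * F := by
    rw [hF, ← f1]; nth_rw 2 [← f2]; rw [← f3]; ring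
  have hFpos : 0 < F := by positivity
  have hd' : lcmUpto (42 * m) ≤ lcmUpto m * (A * B * C) := by
    rw [hfac, ← mul_assoc (lcmUpto m)] at hd
    exact Nat.le_of_mul_le_mul_right hd hFpos
  refine hd'.trans (Nat.mul_le_mul_left _ ?_)
  have hprod := Nat.mul_le_mul (Nat.mul_le_mul h1 h2) h3
  refine Nat.le_of_mul_le_mul_right (c := 2 ^ (14 * m) * 6 ^ (6 * m)) ?_ (by positivity)
  calc A * B * C * (2 ^ (14 * m) * 6 ^ (6 * m))
      = A * 1 ^ (21 * m) * (B * 2 ^ (14 * m)) * (C * 6 ^ (6 * m)) := by rw [one_pow]; ring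
    _ ≤ _ := hprod
    _ = _ := by
      simp only [pow_mul, ← mul_pow]; norm_num

theorem exists_lcmUpto_le : ∃ C : ℝ, 0 < C ∧ ∀ n, (lcmUpto n : ℝ) ≤ C * (16 / 5) ^ n := by
  obtain ⟨C, hC1, hC⟩ : ∃ C : ℝ, 1 ≤ C ∧ ∀ n < 2000, (lcmUpto n : ℝ) ≤ C := by
    refine ⟨1 + ∑ n ∈ range 2000, (lcmUpto n : ℝ), ?_, fun n hn => ?_⟩
    · have : (0 : ℝ) ≤ ∑ n ∈ range 2000, (lcmUpto n : ℝ) := by positivity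
      linarith
    · have := single_le_sum (f := fun n => (lcmUpto n : ℝ)) (fun _ _ => by positivity)
        (mem_range.2 hn)
      linarith
  refine ⟨C, by linarith, fun n => ?_⟩
  induction n using Nat.strong_induction_on with
  | _ n ih =>
    rcases lt_or_ge n 2000 with hn | hn
    · exact (hC n hn).trans (le_mul_of_one_le_right (by linarith) (one_le_pow₀ (by norm_num)))
    · set m := n / 42 + 1 with hm
      have hmono : lcmUpto n ≤ lcmUpto (42 * m) :=
        Nat.le_of_dvd (Nat.lcmUpto_pos _) (Finset.lcm_mono (Icc_subset_Icc le_rfl (by omega)))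
      have h1 : (lcmUpto n : ℝ) ≤ lcmUpto m * (2 ^ 22 * 3 ^ 15 * 7 ^ 7) ^ m := by
        exact_mod_cast hmono.trans (lcmUpto_mul_le (by omega))
      calc (lcmUpto n : ℝ) ≤ lcmUpto m * (2 ^ 22 * 3 ^ 15 * 7 ^ 7) ^ m := h1
        _ ≤ C * (16 / 5) ^ m * (2 ^ 22 * 3 ^ 15 * 7 ^ 7) ^ m := by
          gcongr; exact ih m (by omega)
        _ = C * (16 / 5 * (2 ^ 22 * 3 ^ 15 * 7 ^ 7)) ^ m := by rw [mul_assoc, ← mul_pow]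
        _ ≤ C * ((16 / 5) ^ 41) ^ m := by gcongr; norm_num
        _ ≤ C * (16 / 5) ^ n := by
          rw [← pow_mul]; gcongr
          · norm_num
          · omega

/-- The product `C(n, k) * C(n + k, k)`. -/
def legendreCoeff (n k : ℕ) : ℝ := (n.choose k : ℝ) * ((n + k).choose k : ℝ)

/-- Apéry's weights `c(n, k)`, which tend to `ζ(3)` uniformly in `k`. -/
noncomputable def aperyWeight (n k : ℕ) : ℝ :=
  ∑ m ∈ range n, 1 / ((m : ℝ) + 1) ^ 3 +
    ∑ m ∈ range k, (-1) ^ m / (2 * ((m : ℝ) + 1) ^ 3 * legendreCoeff n (m + 1))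

/-- The Apéry numbers `∑ₖ C(n, k)² C(n + k, k)²`. -/
def aperyA (n : ℕ) : ℝ := ∑ k ∈ range (n + 1), legendreCoeff n k ^ 2

/-- The numerators of Apéry's approximations to `ζ(3)`. -/
noncomputable def aperyB (n : ℕ) : ℝ :=
  ∑ k ∈ range (n + 1), legendreCoeff n k ^ 2 * aperyWeight n k

theorem legendreCoeff_zero_right (n : ℕ) : legendreCoeff n 0 = 1 := by simp [legendreCoeff]

theorem legendreCoeff_eq_zero {n k : ℕ} (h : n < k) : legendreCoeff n k = 0 := by
  simp [legendreCoeff, Nat.choose_eq_zero_of_lt h]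

theorem legendreCoeff_pos {n k : ℕ} (h : k ≤ n) : 0 < legendreCoeff n k := by
  have h1 := Nat.choose_pos h
  have h2 := Nat.choose_pos (Nat.le_add_left k n)
  unfold legendreCoeff
  positivity

theorem legendreCoeff_succ_right (n k : ℕ) :
    legendreCoeff n (k + 1) = legendreCoeff n k * (n + k + 1) * (n - k) / (k + 1) ^ 2 := by
  rcases lt_or_ge n k with h | h
  · rw [legendreCoeff_eq_zero h, legendreCoeff_eq_zero (by omega)]; simp
  have e1 : (n.choose (k + 1) : ℝ) * (k + 1) = n.choose k * (n - k) := by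
    have := Nat.choose_succ_right_eq n k
    rw [← Nat.cast_sub h]; exact_mod_cast this
  have e2 : ((n + k + 1 : ℕ) : ℝ) * (n + k).choose k = (n + k + 1).choose (k + 1) * (k + 1) := by
    have := Nat.add_one_mul_choose_eq (n + k) k
    exact_mod_cast this
  push_cast at e2
  rw [eq_div_iff (by positivity), legendreCoeff, legendreCoeff, ← add_assoc]
  linear_combination ((n + k + 1).choose (k + 1) : ℝ) * (k + 1) * e1
    - (n.choose k : ℝ) * (n - k) * e2

theorem legendreCoeff_succ_left (n k : ℕ) :
    legendreCoeff (n + 1) k * (n + 1 - k) = legendreCoeff n k * (n + k + 1) := by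
  rcases lt_or_ge n k with h | h
  · rw [legendreCoeff_eq_zero h, zero_mul]
    rcases (Nat.succ_le_of_lt h).eq_or_lt with h | h
    · simp [← h]
    · rw [legendreCoeff_eq_zero h, zero_mul]
  have e1 : (n.choose k : ℝ) * (n + 1) = (n + 1).choose k * (n + 1 - k) := by
    have := Nat.choose_mul_succ_eq n k
    rw [← Nat.cast_succ, ← Nat.cast_sub (by omega : k ≤ n.succ)]; exact_mod_cast this
  have e2 : ((n + k).choose k : ℝ) * (n + k + 1) = (n + 1 + k).choose k * (n + 1) := by
    have := Nat.choose_mul_succ_eq (n + k) k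
    rw [show n + k + 1 - k = n + 1 by omega, show n + k + 1 = n + 1 + k by ring] at this
    have h' := congrArg (Nat.cast (R := ℝ)) this
    push_cast at h'
    linarith
  unfold legendreCoeff
  have : (0 : ℝ) < n + 1 := by positivity
  apply mul_right_cancel₀ this.ne'
  linear_combination -((n + 1 + k).choose k : ℝ) * (n + 1) * e1 - (n.choose k : ℝ) * (n + 1) * e2

theorem legendreCoeff_succ_succ (n k : ℕ) :
    legendreCoeff (n + 1) (k + 1) =
      legendreCoeff n k * (n + k + 1) * (n + k + 2) / (k + 1) ^ 2 := by
  rw [legendreCoeff_succ_right, ← legendreCoeff_succ_left n k]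
  push_cast
  ring

theorem legendreCoeff_succ_right_of_succ (n k : ℕ) :
    legendreCoeff n (k + 1) =
      legendreCoeff (n + 1) k * (n + 1 - k) * (n - k) / (k + 1) ^ 2 := by
  rw [legendreCoeff_succ_right, ← legendreCoeff_succ_left]

/-- The polynomial factor of Zagier's certificate for the Apéry numbers. -/
def aperyCert (n k : ℕ) : ℝ :=
  4 * (2 * n + 3) * (k * (2 * k + 1) - (2 * n + 3) ^ 2) * legendreCoeff (n + 1) k ^ 2

theorem sum_range_eq_of_succ {f F : ℕ → ℝ} {N : ℕ} (h0 : f 0 = F 0)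
    (h : ∀ k < N, f (k + 1) = F (k + 1) - F k) : ∑ k ∈ range (N + 1), f k = F N := by
  induction N with
  | zero => simpa using h0
  | succ N ih =>
    rw [sum_range_succ, ih fun k hk => h k (by omega), h N (by omega)]
    ring

theorem sum_range_legendreCoeff {n N : ℕ} (h : n ≤ N) (f : ℕ → ℝ) :
    ∑ k ∈ range (N + 1), legendreCoeff n k ^ 2 * f k =
      ∑ k ∈ range (n + 1), legendreCoeff n k ^ 2 * f k := by
  symm
  apply sum_subset (range_subset_range.2 (by omega))
  intro k _ hk
  rw [legendreCoeff_eq_zero (by simpa using hk)]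
  simp

theorem aperyA_recurrence (n : ℕ) :
    ((n : ℝ) + 2) ^ 3 * aperyA (n + 2) - (2 * n + 3) * (17 * n ^ 2 + 51 * n + 39) * aperyA (n + 1)
      + (n + 1) ^ 3 * aperyA n = 0 := by
  have hA (j : ℕ) (hj : j ≤ n + 2) :
      aperyA j = ∑ k ∈ range (n + 2 + 1), legendreCoeff j k ^ 2 * 1 := by
    rw [sum_range_legendreCoeff hj]; simp [aperyA]
  rw [hA (n + 2) le_rfl, hA (n + 1) (by omega), hA n (by omega), mul_sum, mul_sum, mul_sum,
    ← sum_sub_distrib, ← sum_add_distrib, sum_range_eq_of_succ (F := aperyCert n)]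
  · simp [aperyCert, legendreCoeff_eq_zero]
  · simp only [legendreCoeff_zero_right, aperyCert]
    push_cast
    ring
  · intro k _
    rw [legendreCoeff_succ_right_of_succ n k, legendreCoeff_succ_succ (n + 1) k, aperyCert,
      aperyCert, legendreCoeff_succ_right (n + 1) k]
    push_cast
    field_simp
    ring

theorem aperyWeight_succ_right (n k : ℕ) : aperyWeight n (k + 1) =
    aperyWeight n k + (-1) ^ k / (2 * ((k : ℝ) + 1) ^ 3 * legendreCoeff n (k + 1)) := by
  rw [aperyWeight, aperyWeight, sum_range_succ _ k, add_assoc]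

theorem aperyWeight_succ_left {n k : ℕ} (h : k ≤ n) : aperyWeight (n + 1) k =
    aperyWeight n k + (-1) ^ k / (((n : ℝ) + 1) ^ 2 * (n + 1 + k) * legendreCoeff n k) := by
  induction k with
  | zero =>
    simp only [aperyWeight, sum_range_succ, range_zero, sum_empty, legendreCoeff_zero_right]
    push_cast
    field_simp
    ring
  | succ k ih =>
    have hT := (legendreCoeff_pos (by omega : k ≤ n)).ne'
    have hnk : (n : ℝ) - k ≠ 0 := by
      have : (k : ℝ) + 1 ≤ n := by exact_mod_cast h
      intro h'; linarith
    have h1 : (n : ℝ) + k + 1 ≠ 0 := by positivity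
    have h2 : (n : ℝ) + k + 2 ≠ 0 := by positivity
    have h3 : (n : ℝ) + 1 + k ≠ 0 := by positivity
    rw [aperyWeight_succ_right, aperyWeight_succ_right, ih (by omega), legendreCoeff_succ_succ,
      legendreCoeff_succ_right]
    have h4 : (n : ℝ) + 1 + (k + 1) ≠ 0 := by positivity
    push_cast
    rw [pow_succ]
    field_simp
    ring

theorem aperyB_recurrence_term (n k : ℕ) (hk : k < n + 2) :
    ((n : ℝ) + 2) ^ 3 * (legendreCoeff (n + 2) (k + 1) ^ 2 * aperyWeight (n + 2) (k + 1))
      - (2 * n + 3) * (17 * n ^ 2 + 51 * n + 39) *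
        (legendreCoeff (n + 1) (k + 1) ^ 2 * aperyWeight (n + 1) (k + 1))
      + (n + 1) ^ 3 * (legendreCoeff n (k + 1) ^ 2 * aperyWeight n (k + 1)) =
    (aperyCert n (k + 1) * aperyWeight (n + 1) (k + 1) +
      5 * (2 * n + 3) * (-1) ^ k * (k + 1) / ((n + 1) * (n + 2)) *
        legendreCoeff (n + 1) (k + 1)) -
    (aperyCert n k * aperyWeight (n + 1) k -
      5 * (2 * n + 3) * (-1) ^ k * k / ((n + 1) * (n + 2)) * legendreCoeff (n + 1) k) := by
  have hT := (legendreCoeff_pos (by omega : k ≤ n + 1)).ne'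
  have h2 : (n : ℝ) + k + 2 ≠ 0 := by positivity
  have h3 : (n : ℝ) + k + 3 ≠ 0 := by positivity
  have t2 : legendreCoeff (n + 2) (k + 1) =
      legendreCoeff (n + 1) k * (n + k + 2) * (n + k + 3) / (k + 1) ^ 2 := by
    rw [legendreCoeff_succ_succ (n + 1) k]; push_cast; ring
  have t1 : legendreCoeff (n + 1) (k + 1) =
      legendreCoeff (n + 1) k * (n + k + 2) * (n + 1 - k) / (k + 1) ^ 2 := by
    rw [legendreCoeff_succ_right (n + 1) k]; push_cast; ring
  have t0 := legendreCoeff_succ_right_of_succ n k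
  rcases (Nat.lt_succ_iff.1 hk).eq_or_lt with rfl | hk'
  · have e1 : legendreCoeff (n + 1) (n + 1 + 1) = 0 := legendreCoeff_eq_zero (by omega)
    have e0 : legendreCoeff n (n + 1 + 1) = 0 := legendreCoeff_eq_zero (by omega)
    rw [aperyWeight_succ_right (n + 2), aperyWeight_succ_left (n := n + 1) le_rfl, aperyCert,
      aperyCert, e1, e0, t2]
    push_cast at *
    have h4 : (n : ℝ) + 1 + 1 + (n + 1) ≠ 0 := by positivity
    have h5 : (n : ℝ) + (n + 1) + 2 ≠ 0 := by positivity
    have h6 : (n : ℝ) + (n + 1) + 3 ≠ 0 := by positivity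
    have h7 : (n : ℝ) + 1 + 1 ≠ 0 := by positivity
    have h8 : (n : ℝ) + 2 ≠ 0 := by positivity
    field_simp
    ring
  · have hnk : (n : ℝ) + 1 - k ≠ 0 := by
      have : (k : ℝ) < n + 1 := by exact_mod_cast hk'
      intro h'; linarith
    have w0 : legendreCoeff n (k + 1) ^ 2 * aperyWeight n (k + 1) =
        legendreCoeff n (k + 1) ^ 2 * aperyWeight (n + 1) (k + 1) +
          legendreCoeff n (k + 1) * (-1) ^ k / (((n : ℝ) + 1) ^ 2 * (n + k + 2)) := by
      rcases (Nat.lt_succ_iff.1 hk').eq_or_lt with rfl | hk''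
      · rw [legendreCoeff_eq_zero (by omega : k < k + 1)]; simp
      · have := (legendreCoeff_pos (by omega : k + 1 ≤ n)).ne'
        rw [aperyWeight_succ_left (by omega : k + 1 ≤ n)]
        have h4 : (n : ℝ) + 1 + (k + 1) ≠ 0 := by positivity
        push_cast
        rw [pow_succ (-1 : ℝ)]
        field_simp
        ring
    rw [w0, aperyWeight_succ_left (n := n + 1) (by omega : k + 1 ≤ n + 1),
      aperyWeight_succ_right (n + 1) k, aperyCert, aperyCert, t2, t1, t0]
    have h4 : (n : ℝ) + 1 + 1 + (k + 1) ≠ 0 := by positivity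
    have h7 : (n : ℝ) + 1 + 1 ≠ 0 := by positivity
    have h8 : (n : ℝ) + 2 ≠ 0 := by positivity
    push_cast
    rw [pow_succ (-1 : ℝ)]
    generalize (-1 : ℝ) ^ k = s
    generalize aperyWeight (n + 1) k = c
    generalize legendreCoeff (n + 1) k = t at *
    field_simp
    ring

theorem aperyB_recurrence (n : ℕ) :
    ((n : ℝ) + 2) ^ 3 * aperyB (n + 2) - (2 * n + 3) * (17 * n ^ 2 + 51 * n + 39) * aperyB (n + 1)
      + (n + 1) ^ 3 * aperyB n = 0 := by
  have hB (j : ℕ) (hj : j ≤ n + 2) :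
      aperyB j = ∑ k ∈ range (n + 2 + 1), legendreCoeff j k ^ 2 * aperyWeight j k := by
    rw [sum_range_legendreCoeff hj, aperyB]
  rw [hB (n + 2) le_rfl, hB (n + 1) (by omega), hB n (by omega), mul_sum, mul_sum, mul_sum,
    ← sum_sub_distrib, ← sum_add_distrib, sum_range_eq_of_succ
      (F := fun k => aperyCert n k * aperyWeight (n + 1) k -
        5 * (2 * n + 3) * (-1) ^ k * k / ((n + 1) * (n + 2)) * legendreCoeff (n + 1) k)]
  · simp [aperyCert, legendreCoeff_eq_zero]
  · simp only [legendreCoeff_zero_right, aperyCert, aperyWeight, sum_range_succ _ (n + 1),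
      sum_range_succ _ n, range_zero, sum_empty]
    push_cast
    field_simp
    ring
  · intro k hk
    rw [aperyB_recurrence_term n k hk, pow_succ (-1 : ℝ)]
    push_cast
    ring

theorem aperyA_zero : aperyA 0 = 1 := by simp [aperyA, legendreCoeff]

theorem aperyA_one : aperyA 1 = 5 := by
  norm_num [aperyA, legendreCoeff, sum_range_succ]

theorem aperyB_zero : aperyB 0 = 0 := by simp [aperyB, aperyWeight]

theorem aperyB_one : aperyB 1 = 6 := by
  norm_num [aperyB, aperyWeight, legendreCoeff, sum_range_succ]

theorem aperyA_pos (n : ℕ) : 0 < aperyA n :=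
  sum_pos (fun k hk => pow_pos (legendreCoeff_pos (by simpa [Nat.lt_succ_iff] using hk)) 2)
    (by simp)

theorem five_mul_aperyA_le (n : ℕ) : 5 * aperyA n ≤ aperyA (n + 1) := by
  induction n with
  | zero => norm_num [aperyA_zero, aperyA_one]
  | succ n ih =>
    have hr := aperyA_recurrence n
    have hp := aperyA_pos (n + 1)
    have hn : (0 : ℝ) ≤ n := n.cast_nonneg
    have h1 : ((n : ℝ) + 1) ^ 3 * (5 * aperyA n) ≤ (n + 1) ^ 3 * aperyA (n + 1) := by gcongr
    have h2 : 0 ≤ ((2 * (n : ℝ) + 3) * (17 * n ^ 2 + 51 * n + 39) - (n + 1) ^ 3 / 5 -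
        5 * (n + 2) ^ 3) * aperyA (n + 1) := by
      apply mul_nonneg _ hp.le
      ring_nf
      positivity
    have h3 : (0 : ℝ) < (n + 2) ^ 3 := by positivity
    refine le_of_mul_le_mul_left ?_ h3
    linarith

theorem aperyA_growth {n : ℕ} (h : 100 ≤ n) : 33 * aperyA (n + 1) ≤ aperyA (n + 2) := by
  have hr := aperyA_recurrence n
  have hp := aperyA_pos (n + 1)
  have hn : (100 : ℝ) ≤ n := by exact_mod_cast h
  have h1 : ((n : ℝ) + 1) ^ 3 * (5 * aperyA n) ≤ (n + 1) ^ 3 * aperyA (n + 1) := by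
    gcongr; exact five_mul_aperyA_le n
  have h2 : 0 ≤ ((2 * (n : ℝ) + 3) * (17 * n ^ 2 + 51 * n + 39) - (n + 1) ^ 3 / 5 -
      33 * (n + 2) ^ 3) * aperyA (n + 1) := by
    apply mul_nonneg _ hp.le
    obtain ⟨x, hx⟩ : ∃ x : ℝ, x = n - 100 := ⟨_, rfl⟩
    have hx0 : 0 ≤ x := by linarith
    rw [show (n : ℝ) = x + 100 by linarith]
    ring_nf
    positivity
  have h3 : (0 : ℝ) < (n + 2) ^ 3 := by positivity
  refine le_of_mul_le_mul_left ?_ h3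
  linarith

theorem pow_le_aperyA (j : ℕ) : (33 : ℝ) ^ j ≤ aperyA (101 + j) := by
  induction j with
  | zero =>
    have h (n : ℕ) : 1 ≤ aperyA n := by
      induction n with
      | zero => rw [aperyA_zero]
      | succ n ih => linarith [five_mul_aperyA_le n]
    simpa using h 101
  | succ j ih =>
    have := aperyA_growth (n := 100 + j) (by omega)
    rw [show 100 + j + 1 = 101 + j by ring, show 100 + j + 2 = 101 + (j + 1) by ring] at this
    rw [pow_succ]
    linarith

theorem apery_casoratian (n : ℕ) :
    ((n : ℝ) + 1) ^ 3 * (aperyB (n + 1) * aperyA n - aperyA (n + 1) * aperyB n) = 6 := by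
  induction n with
  | zero => norm_num [aperyA_zero, aperyA_one, aperyB_zero, aperyB_one]
  | succ n ih =>
    push_cast
    linear_combination ih + aperyA (n + 1) * aperyB_recurrence n -
      aperyB (n + 1) * aperyA_recurrence n

theorem aperyB_div_aperyA_succ_sub (n : ℕ) :
    aperyB (n + 1) / aperyA (n + 1) - aperyB n / aperyA n =
      6 / (((n : ℝ) + 1) ^ 3 * (aperyA n * aperyA (n + 1))) := by
  have h := apery_casoratian n
  have h1 := (aperyA_pos n).ne'
  have h2 := (aperyA_pos (n + 1)).ne'
  field_simp
  linear_combination h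

theorem strictMono_aperyB_div_aperyA : StrictMono fun n => aperyB n / aperyA n := by
  refine strictMono_nat_of_lt_succ fun n => ?_
  rw [← sub_pos, aperyB_div_aperyA_succ_sub]
  have h1 := aperyA_pos n
  have h2 := aperyA_pos (n + 1)
  positivity

theorem antitone_aperyB_div_aperyA_add :
    Antitone fun n => aperyB n / aperyA n + 2 / aperyA n ^ 2 := by
  refine antitone_nat_of_succ_le fun n => ?_
  have h1 := aperyA_pos n
  have h2 := aperyA_pos (n + 1)
  have h5 := five_mul_aperyA_le n
  have h := aperyB_div_aperyA_succ_sub n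
  have hA : 6 / (((n : ℝ) + 1) ^ 3 * (aperyA n * aperyA (n + 1))) ≤
      6 / (1 * (aperyA n * (5 * aperyA n))) := by
    gcongr
    exact one_le_pow₀ (by linarith [(n.cast_nonneg : (0 : ℝ) ≤ n)])
  have hB : 2 / aperyA (n + 1) ^ 2 ≤ 2 / (5 * aperyA n) ^ 2 := by gcongr
  have hC : 6 / (1 * (aperyA n * (5 * aperyA n))) + 2 / (5 * aperyA n) ^ 2 ≤ 2 / aperyA n ^ 2 := by
    rw [← sub_nonneg]
    have : 2 / aperyA n ^ 2 - (6 / (1 * (aperyA n * (5 * aperyA n))) + 2 / (5 * aperyA n) ^ 2) =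
        (18 / 25) / aperyA n ^ 2 := by
      field_simp
      norm_num
    rw [this]
    positivity
  linarith

theorem hasSum_zetaR_three : HasSum (fun n : ℕ => 1 / ((n : ℝ) + 1) ^ 3) (zetaR 3) := by
  have h := (summable_nat_add_iff 1).2 (Real.summable_one_div_nat_pow.2 (by norm_num : 1 < 3))
  push_cast at h
  exact h.hasSum

theorem succ_le_legendreCoeff {n m : ℕ} (h : m + 1 ≤ n) :
    (n : ℝ) + 1 ≤ legendreCoeff n (m + 1) := by
  have h1 : 1 ≤ n.choose (m + 1) := Nat.choose_pos h
  have h2 : n + 1 ≤ (n + (m + 1)).choose (m + 1) := by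
    rw [← Nat.choose_symm_add]
    calc n + 1 = (n + 1).choose n := by simp
      _ ≤ _ := Nat.choose_le_choose n (by omega)
  unfold legendreCoeff
  exact_mod_cast (by nlinarith : n + 1 ≤ n.choose (m + 1) * (n + (m + 1)).choose (m + 1))

theorem abs_aperyWeight_sub_le {n k : ℕ} (h : k ≤ n) :
    |aperyWeight n k - ∑ m ∈ range n, 1 / ((m : ℝ) + 1) ^ 3| ≤ zetaR 3 / (n + 1) := by
  rw [aperyWeight, add_sub_cancel_left]
  calc _ ≤ ∑ m ∈ range k, |(-1) ^ m / (2 * ((m : ℝ) + 1) ^ 3 * legendreCoeff n (m + 1))| :=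
        abs_sum_le_sum_abs _ _
    _ ≤ ∑ m ∈ range k, 1 / ((m : ℝ) + 1) ^ 3 / (n + 1) := by
        refine sum_le_sum fun m hm => ?_
        have hmn : m + 1 ≤ n := by have := mem_range.1 hm; omega
        have hT := legendreCoeff_pos hmn
        rw [abs_div, abs_pow, abs_neg, abs_one, one_pow, abs_of_pos (by positivity), div_div]
        gcongr
        · linarith [pow_pos (by positivity : (0 : ℝ) < m + 1) 3]
        · exact succ_le_legendreCoeff hmn
    _ = (∑ m ∈ range k, 1 / ((m : ℝ) + 1) ^ 3) / (n + 1) := by rw [sum_div]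
    _ ≤ _ := by
        gcongr
        exact sum_le_hasSum _ (fun _ _ => by positivity) hasSum_zetaR_three

theorem tendsto_aperyB_div_aperyA :
    Tendsto (fun n => aperyB n / aperyA n) atTop (𝓝 (zetaR 3)) := by
  have hH := hasSum_zetaR_three.tendsto_sum_nat
  have hb (n : ℕ) : |aperyB n / aperyA n - ∑ m ∈ range n, 1 / ((m : ℝ) + 1) ^ 3| ≤
      zetaR 3 / (n + 1) := by
    have hp := aperyA_pos n
    rw [div_sub' hp.ne', abs_div, abs_of_pos hp, div_le_iff₀ hp, mul_comm (aperyA n), aperyA,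
      aperyB, mul_sum, mul_sum, ← sum_sub_distrib]
    refine (abs_sum_le_sum_abs _ _).trans (sum_le_sum fun k hk => ?_)
    rw [mul_comm _ (legendreCoeff n k ^ 2), ← mul_sub, abs_mul, abs_of_nonneg (sq_nonneg _),
      mul_comm]
    gcongr
    exact abs_aperyWeight_sub_le (by simpa [Nat.lt_succ_iff] using hk)
  have h0 : Tendsto (fun n : ℕ => zetaR 3 / ((n : ℝ) + 1)) atTop (𝓝 0) :=
    tendsto_const_nhds.div_atTop (tendsto_atTop_add_const_right _ _ tendsto_natCast_atTop_atTop)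
  have h1 : Tendsto (fun n => aperyB n / aperyA n - ∑ m ∈ range n, 1 / ((m : ℝ) + 1) ^ 3)
      atTop (𝓝 0) := squeeze_zero_norm hb h0
  simpa using h1.add hH

theorem aperyB_lt (n : ℕ) : aperyB n < aperyA n * zetaR 3 := by
  have h1 := strictMono_aperyB_div_aperyA n.lt_succ_self
  have h2 := strictMono_aperyB_div_aperyA.monotone.ge_of_tendsto tendsto_aperyB_div_aperyA (n + 1)
  rw [mul_comm, ← div_lt_iff₀ (aperyA_pos n)]
  exact h1.trans_le h2

theorem aperyA_mul_zetaR_sub_le (n : ℕ) :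
    aperyA n * zetaR 3 - aperyB n ≤ 2 / aperyA n := by
  have hp := aperyA_pos n
  have h : zetaR 3 ≤ aperyB n / aperyA n + 2 / aperyA n ^ 2 := by
    refine le_of_tendsto tendsto_aperyB_div_aperyA ?_
    filter_upwards [eventually_ge_atTop n] with m hm
    have h1 := antitone_aperyB_div_aperyA_add hm
    have h2 : 0 ≤ 2 / aperyA m ^ 2 := by positivity
    simp only at h1
    linarith
  have h' := mul_le_mul_of_nonneg_left h hp.le
  have e : aperyA n * (aperyB n / aperyA n + 2 / aperyA n ^ 2) = aperyB n + 2 / aperyA n := by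
    field_simp
  linarith

theorem div_mem_range_intCast {a b : ℕ} (h : a ∣ b) :
    (b : ℝ) / a ∈ (Int.castRingHom ℝ).range := by
  obtain ⟨c, rfl⟩ := h
  rcases eq_or_ne a 0 with rfl | ha
  · simp
  · have : (a : ℝ) ≠ 0 := by exact_mod_cast ha
    rw [Nat.cast_mul, mul_div_cancel_left₀ _ this]
    exact natCast_mem _ c

theorem lcmUpto_dvd_lcmUpto {m n : ℕ} (h : m ≤ n) : lcmUpto m ∣ lcmUpto n :=
  Finset.lcm_mono (Icc_subset_Icc le_rfl h)

theorem dvd_lcmUpto {m n : ℕ} (h0 : 1 ≤ m) (h : m ≤ n) : m ∣ lcmUpto n :=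
  Finset.dvd_lcm (f := id) (mem_Icc.2 ⟨h0, h⟩)

theorem lcmUpto_div_mul_choose_mem_self (j : ℕ) : ∀ n, j + 1 ≤ n →
    (lcmUpto n : ℝ) / (((j : ℝ) + 1) * n.choose (j + 1)) ∈ (Int.castRingHom ℝ).range := by
  induction j with
  | zero =>
    intro n hn
    simpa using div_mem_range_intCast (dvd_lcmUpto hn le_rfl)
  | succ j ih =>
    intro n hn
    obtain ⟨n, rfl⟩ : ∃ k, n = k + 1 := ⟨n - 1, by omega⟩
    have hj : j + 1 ≤ n := by omega
    have hd : (lcmUpto n : ℝ) ≠ 0 := by exact_mod_cast Nat.lcmUpto_ne_zero n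
    have h1 := mul_mem (div_mem_range_intCast (lcmUpto_dvd_lcmUpto n.le_succ)) (ih n hj)
    rw [div_mul_div_cancel₀ hd] at h1
    have h2 := sub_mem h1 (ih (n + 1) (by omega))
    convert h2 using 1
    have c0 : ((n.choose (j + 1) : ℕ) : ℝ) ≠ 0 := by exact_mod_cast (Nat.choose_pos hj).ne'
    have c1 : (((n + 1).choose (j + 1) : ℕ) : ℝ) ≠ 0 := by
      exact_mod_cast (Nat.choose_pos (by omega : j + 1 ≤ n + 1)).ne'
    have c2 : (((n + 1).choose (j + 2) : ℕ) : ℝ) ≠ 0 := by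
      exact_mod_cast (Nat.choose_pos (by omega : j + 2 ≤ n + 1)).ne'
    have e1 : ((n : ℝ) + 1) * n.choose (j + 1) = (n + 1).choose (j + 2) * (j + 2) := by
      exact_mod_cast Nat.add_one_mul_choose_eq n (j + 1)
    have e2 : (n.choose (j + 1) : ℝ) * (n + 1) = (n + 1).choose (j + 1) * (n - j) := by
      have := Nat.choose_mul_succ_eq n (j + 1)
      rw [show n + 1 - (j + 1) = n - j by omega] at this
      rw [← Nat.cast_sub (by omega : j ≤ n)]
      exact_mod_cast this
    have hn0 : (n : ℝ) + 1 ≠ 0 := by positivity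
    have hj0 : (j : ℝ) + 2 ≠ 0 := by positivity
    have hnj : (n : ℝ) - j ≠ 0 := by
      have : (j : ℝ) + 1 ≤ n := by exact_mod_cast hj
      intro h'; linarith
    have s1 : ((n + 1).choose (j + 1) : ℝ) = n.choose (j + 1) * (n + 1) / (n - j) := by
      rw [e2]; field_simp
    have s2 : ((n + 1).choose (j + 2) : ℝ) = (n + 1) * n.choose (j + 1) / (j + 2) := by
      rw [e1]; field_simp
    rw [show j + 1 + 1 = j + 2 by ring, s1, s2]
    have hj1 : (j : ℝ) + 1 + 1 ≠ 0 := by positivity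
    push_cast
    field_simp
    ring

theorem lcmUpto_div_mul_choose_mem {j k n : ℕ} (hj : j + 1 ≤ k) (hk : k ≤ n) :
    (lcmUpto n : ℝ) / (((j : ℝ) + 1) * k.choose (j + 1)) ∈ (Int.castRingHom ℝ).range := by
  have hd : (lcmUpto k : ℝ) ≠ 0 := by exact_mod_cast Nat.lcmUpto_ne_zero k
  have h := mul_mem (div_mem_range_intCast (lcmUpto_dvd_lcmUpto hk))
    (lcmUpto_div_mul_choose_mem_self j k hj)
  rwa [div_mul_div_cancel₀ hd] at h

theorem choose_mul_choose_add {m k n : ℕ} (h : m ≤ k) :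
    (n + k).choose k * k.choose m = (n + m).choose m * (n + k).choose (k - m) := by
  obtain ⟨d, rfl⟩ := Nat.exists_eq_add_of_le h
  have e1 := Nat.choose_mul (n := n + (m + d)) (k := m + d) (s := m) (by omega)
  have e2 := Nat.choose_mul (n := n + (m + d)) (k := n + m) (s := m) (by omega)
  rw [show n + (m + d) - m = n + d by omega, show m + d - m = d by omega] at e1
  rw [show n + (m + d) - m = n + d by omega, show n + m - m = n by omega] at e2
  rw [e1, show m + d - m = d by omega, ← Nat.choose_symm_add (a := n) (b := d), ← e2, mul_comm,
    show n + (m + d) = n + m + d by ring, Nat.choose_symm_add (a := n + m) (b := d)]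

theorem lcmUpto_pow_mul_choose_div_mem {j k n : ℕ} (hj : j + 1 ≤ k) (hk : k ≤ n) :
    (lcmUpto n : ℝ) ^ 3 * (n + k).choose k / (((j : ℝ) + 1) ^ 3 * legendreCoeff n (j + 1)) ∈
      (Int.castRingHom ℝ).range := by
  have h1 := div_mem_range_intCast (dvd_lcmUpto (m := j + 1) (n := n) (by omega) (by omega))
  have h2 := lcmUpto_div_mul_choose_mem (hj.trans hk) le_rfl
  have h3 := lcmUpto_div_mul_choose_mem hj hk
  have h := mul_mem (mul_mem (mul_mem h1 h2) h3)
    (natCast_mem (Int.castRingHom ℝ).range ((n + k).choose (k - (j + 1))))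
  convert h using 1
  have e : ((n + k).choose k : ℝ) * k.choose (j + 1) =
      (n + (j + 1)).choose (j + 1) * (n + k).choose (k - (j + 1)) := by
    exact_mod_cast choose_mul_choose_add hj
  have c1 : ((k.choose (j + 1) : ℕ) : ℝ) ≠ 0 := by exact_mod_cast (Nat.choose_pos hj).ne'
  have c2 : ((n.choose (j + 1) : ℕ) : ℝ) ≠ 0 := by
    exact_mod_cast (Nat.choose_pos (hj.trans hk)).ne'
  have c3 : (((n + (j + 1)).choose (j + 1) : ℕ) : ℝ) ≠ 0 := by
    exact_mod_cast (Nat.choose_pos (Nat.le_add_left _ _)).ne'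
  unfold legendreCoeff
  push_cast
  field_simp
  linear_combination (lcmUpto n : ℝ) ^ 3 * e

theorem legendreCoeff_mem (n k : ℕ) : legendreCoeff n k ∈ (Int.castRingHom ℝ).range :=
  mul_mem (natCast_mem _ _) (natCast_mem _ _)

theorem aperyA_mem (n : ℕ) : aperyA n ∈ (Int.castRingHom ℝ).range :=
  sum_mem fun k _ => pow_mem (legendreCoeff_mem n k) 2

theorem lcmUpto_mul_aperyWeight_mem {n k : ℕ} (hk : k ≤ n) :
    2 * (lcmUpto n : ℝ) ^ 3 * (legendreCoeff n k * aperyWeight n k) ∈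
      (Int.castRingHom ℝ).range := by
  have e : 2 * (lcmUpto n : ℝ) ^ 3 * (legendreCoeff n k * aperyWeight n k) =
      ((2 : ℕ) : ℝ) * legendreCoeff n k * ∑ m ∈ range n, ((lcmUpto n : ℝ) / (m + 1 : ℕ)) ^ 3 +
        n.choose k * ∑ m ∈ range k, (-1) ^ m * ((lcmUpto n : ℝ) ^ 3 * (n + k).choose k /
          (((m : ℝ) + 1) ^ 3 * legendreCoeff n (m + 1))) := by
    rw [aperyWeight, mul_add, mul_add]
    congr 1
    · simp only [mul_sum]
      refine sum_congr rfl fun m _ => ?_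
      push_cast
      field_simp
    · simp only [mul_sum]
      refine sum_congr rfl fun m hm => ?_
      have hT := (legendreCoeff_pos (n := n) (k := m + 1)
        (by have := mem_range.1 hm; omega)).ne'
      rw [legendreCoeff.eq_1 n k]
      field_simp
  rw [e]
  refine add_mem (mul_mem (mul_mem (natCast_mem _ _) (legendreCoeff_mem n k)) (sum_mem ?_))
    (mul_mem (natCast_mem _ _) (sum_mem ?_))
  · intro m hm
    exact pow_mem (div_mem_range_intCast (dvd_lcmUpto (by omega)
      (by have := mem_range.1 hm; omega))) 3
  · intro m hm
    exact mul_mem (pow_mem (neg_mem (one_mem _)) m)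
      (lcmUpto_pow_mul_choose_div_mem (by have := mem_range.1 hm; omega) hk)

theorem lcmUpto_mul_aperyB_mem (n : ℕ) :
    2 * (lcmUpto n : ℝ) ^ 3 * aperyB n ∈ (Int.castRingHom ℝ).range := by
  rw [aperyB, mul_sum]
  refine sum_mem fun k hk => ?_
  have h := mul_mem (legendreCoeff_mem n k)
    (lcmUpto_mul_aperyWeight_mem (n := n) (k := k) (by simpa [Nat.lt_succ_iff] using hk))
  convert h using 1
  ring

/-- (Apéry) `ζ(3)` is irrational. -/
theorem apery_zeta3_irrational : Irrational (zetaR 3) := by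
  rintro ⟨r, hr⟩
  obtain ⟨C, hC0, hC⟩ := exists_lcmUpto_le
  have hq : (0 : ℝ) < r.den := by exact_mod_cast r.den_pos
  have hz : (r.den : ℝ) * zetaR 3 = r.num := by
    rw [← hr, mul_comm]
    exact_mod_cast r.mul_den_eq_num
  have hmain (n : ℕ) : aperyA n ≤ 4 * r.den * (lcmUpto n : ℝ) ^ 3 := by
    have hp := aperyA_pos n
    have hd : (0 : ℝ) < lcmUpto n := by exact_mod_cast Nat.lcmUpto_pos n
    have hL := sub_pos.2 (aperyB_lt n)
    have hmem : 2 * (lcmUpto n : ℝ) ^ 3 * (r.den * (aperyA n * zetaR 3 - aperyB n)) ∈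
        (Int.castRingHom ℝ).range := by
      have h := sub_mem (mul_mem (mul_mem (natCast_mem (Int.castRingHom ℝ).range
        (2 * lcmUpto n ^ 3)) (aperyA_mem n)) (intCast_mem _ r.num))
        (mul_mem (natCast_mem _ r.den) (lcmUpto_mul_aperyB_mem n))
      convert h using 1
      push_cast
      rw [← hz]
      ring
    obtain ⟨z, hzz⟩ := hmem
    rw [eq_intCast] at hzz
    have hpos : (0 : ℝ) < z := by rw [hzz]; positivity
    have hone : (1 : ℝ) ≤ z := by
      have : 0 < z := by exact_mod_cast hpos
      exact_mod_cast this
    have hle : (z : ℝ) ≤ 2 * (lcmUpto n : ℝ) ^ 3 * (r.den * (2 / aperyA n)) := by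
      rw [hzz]
      gcongr
      exact aperyA_mul_zetaR_sub_le n
    have h1 := mul_le_mul_of_nonneg_right (hone.trans hle) hp.le
    have e : 2 * (lcmUpto n : ℝ) ^ 3 * (r.den * (2 / aperyA n)) * aperyA n =
        4 * r.den * (lcmUpto n : ℝ) ^ 3 := by
      field_simp
      ring
    linarith
  set K : ℝ := 4 * r.den * C ^ 3 * (4096 / 125) ^ 101 with hK
  have hKpos : 0 < K := by positivity
  have hbound (j : ℕ) : (33 : ℝ) ^ j ≤ K * (4096 / 125) ^ j := by
    calc (33 : ℝ) ^ j ≤ aperyA (101 + j) := pow_le_aperyA j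
      _ ≤ 4 * r.den * (lcmUpto (101 + j) : ℝ) ^ 3 := hmain _
      _ ≤ 4 * r.den * (C * (16 / 5) ^ (101 + j)) ^ 3 := by gcongr; exact hC _
      _ = K * (4096 / 125) ^ j := by
        rw [hK, mul_pow, ← pow_mul, mul_comm (101 + j), pow_mul, pow_add]
        norm_num only
        ring
  obtain ⟨j, hj⟩ := exists_pow_lt_of_lt_one (inv_pos.2 hKpos)
    (by norm_num : (4096 / 125 / 33 : ℝ) < 1)
  rw [div_pow, div_lt_iff₀ (by positivity), inv_mul_eq_div, lt_div_iff₀ hKpos, mul_comm] at hj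
  exact absurd (hbound j) (not_le.2 hj)
end

section
/- (Ball–Rivoal) The ℚ-vector subspace of ℝ spanned by the numbers 1, ζ(3), ζ(5), ζ(7), … (i.e. by 1 together with all values ζ(2k+1) for k ≥ 1) is infinite-dimensional. In particular there exist infinitely many integers k ≥ 1 such that ζ(2k+1) is irrational. -/
section

open Finset

/-- Dirichlet's simultaneous approximation theorem. -/
theorem exists_simultaneous_approx (d : ℕ) (η : Fin d → ℝ) (T : ℕ) (hT : 0 < T) :
    ∃ q : ℕ, 0 < q ∧ q ≤ T ^ d ∧ ∃ p : Fin d → ℤ, ∀ j, |q * η j - p j| ≤ 1 / T := by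
  classical
  have hT' : (0 : ℝ) < T := by exact_mod_cast hT
  let box : ℕ → Fin d → ℕ := fun q j ↦ ⌊Int.fract (q * η j) * T⌋₊
  have hmaps : ∀ q ∈ range (T ^ d + 1), box q ∈ Fintype.piFinset fun _ : Fin d ↦ range T := by
    intro q _
    simp only [Fintype.mem_piFinset, mem_range, box]
    intro j
    rw [Nat.floor_lt (by positivity)]
    have := Int.fract_lt_one (q * η j)
    nlinarith
  obtain ⟨q₁, -, q₂, -, hlt, hle, heq⟩ :
      ∃ q₁ ∈ range (T ^ d + 1), ∃ q₂ ∈ range (T ^ d + 1), q₁ < q₂ ∧ q₂ ≤ T ^ d ∧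
        box q₁ = box q₂ := by
    obtain ⟨x, hx, y, hy, hne, hxy⟩ := exists_ne_map_eq_of_card_lt_of_maps_to
      (s := range (T ^ d + 1)) (t := Fintype.piFinset fun _ : Fin d ↦ range T) (by simp) hmaps
    rcases lt_or_gt_of_ne hne with h | h
    · exact ⟨x, hx, y, hy, h, by simp at hy; omega, hxy⟩
    · exact ⟨y, hy, x, hx, h, by simp at hx; omega, hxy.symm⟩
  refine ⟨q₂ - q₁, by omega, by omega, fun j ↦ ⌊q₂ * η j⌋ - ⌊q₁ * η j⌋, fun j ↦ ?_⟩
  have h := congrFun heq j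
  simp only [box] at h
  have e₁ := Int.floor_add_fract (q₁ * η j)
  have e₂ := Int.floor_add_fract (q₂ * η j)
  have l₁ := Nat.floor_le (show 0 ≤ Int.fract (q₁ * η j) * T by positivity)
  have l₂ := Nat.floor_le (show 0 ≤ Int.fract (q₂ * η j) * T by positivity)
  have u₁ := Nat.lt_floor_add_one (Int.fract (q₁ * η j) * T)
  have u₂ := Nat.lt_floor_add_one (Int.fract (q₂ * η j) * T)
  rw [h] at l₁ u₁
  rw [le_div_iff₀ hT']
  refine (congrArg _ (abs_of_pos hT').symm).trans_le ?_
  rw [← abs_mul]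
  push_cast [Nat.cast_sub hlt.le]
  have : ((q₂ - q₁ : ℝ) * η j - (⌊q₂ * η j⌋ - ⌊q₁ * η j⌋)) * T
      = Int.fract (q₂ * η j) * T - Int.fract (q₁ * η j) * T := by
    rw [← Int.self_sub_floor, ← Int.self_sub_floor]; ring
  rw [this, abs_le]
  constructor <;> linarith

/-- A weak form of Nesterenko's criterion: integral linear forms in `1, η₁, …, η_d` cannot be
too small compared with their coefficients, provided that they are not too erratic. -/
theorem no_small_linear_forms (d : ℕ) (η : Fin d → ℝ) {A B G α β γ : ℝ} (hA : 1 ≤ A)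
    (hB : 0 < B) (hG : 0 < G) (hα : 0 < α) (hα1 : α < 1) (hβ : 0 < β) (hγ : 0 < γ)
    (hκ : (α * β / γ) ^ (d + 1) * α ≤ 1)
    (h : ∀ m : ℕ, ∃ (P₀ : ℤ) (P : Fin d → ℤ), G * γ ^ m ≤ P₀ + ∑ j, P j * η j ∧
      P₀ + ∑ j, P j * η j ≤ A * α ^ m ∧ ∑ j, |(P j : ℝ)| ≤ B * β ^ m) : False := by
  set C₁ : ℝ := 4 * B * (A / (G * α)) with hC₁
  have hC₁0 : 0 < C₁ := by positivity
  set C₂ : ℝ := C₁ ^ (d + 1) * (2 * A / α) with hC₂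
  obtain ⟨T, hT⟩ := exists_nat_gt (max C₂ 1)
  have hT1 : (1 : ℝ) < T := (le_max_right _ _).trans_lt hT
  have hTC : C₂ < T := (le_max_left _ _).trans_lt hT
  have hT0 : 0 < T := by
    have : (0 : ℝ) < T := by linarith
    exact_mod_cast this
  obtain ⟨q, hq0, hqT, p, hp⟩ := exists_simultaneous_approx d η T hT0
  have hq1 : (1 : ℝ) ≤ q := by exact_mod_cast hq0
  have hqT' : (q : ℝ) ≤ T ^ d := by exact_mod_cast hqT
  obtain ⟨m, hm1, hm2⟩ : ∃ m : ℕ, 2 * A * q * α ^ m ≤ 1 ∧ α ≤ 2 * A * q * α ^ m := by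
    classical
    have hex : ∃ m : ℕ, 2 * A * q * α ^ m ≤ 1 := by
      obtain ⟨m, hm⟩ := exists_pow_lt_of_lt_one (show 0 < 1 / (2 * A * q) by positivity) hα1
      refine ⟨m, ?_⟩
      rw [lt_div_iff₀ (by positivity)] at hm
      linarith
    refine ⟨Nat.find hex, Nat.find_spec hex, ?_⟩
    rcases hk : Nat.find hex with _ | k
    · simp only [pow_zero, mul_one]
      nlinarith
    · have := Nat.find_min hex (m := k) (by omega)
      push Not at this
      rw [pow_succ]
      nlinarith
  obtain ⟨P₀, P, hlow, hup, hP⟩ := h m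
  set S : ℝ := P₀ + ∑ j, P j * η j with hS
  have hS0 : 0 < S := lt_of_lt_of_le (by positivity) hlow
  have hqS : 2 * q * S ≤ 1 := by
    calc 2 * q * S ≤ 2 * q * (A * α ^ m) := by gcongr
      _ ≤ 1 := by linarith
  obtain ⟨M, hM1, hM2⟩ : ∃ M : ℕ, 2 * q * S * M ≤ 1 ∧ 1 / 2 ≤ 2 * q * S * M := by
    have hx : 0 < 2 * q * S := by positivity
    have h1 : 1 ≤ 1 / (2 * q * S) := by rwa [le_div_iff₀ hx, one_mul]
    refine ⟨⌊1 / (2 * q * S)⌋₊, ?_, ?_⟩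
    · have := Nat.floor_le (show 0 ≤ 1 / (2 * q * S) by positivity)
      rwa [le_div_iff₀ hx, mul_comm] at this
    · have h2 := Nat.lt_floor_add_one (1 / (2 * q * S))
      have h3 : (1 : ℝ) ≤ ⌊1 / (2 * q * S)⌋₊ := by
        exact_mod_cast Nat.one_le_floor_iff _ |>.2 h1
      rw [div_lt_iff₀ hx] at h2
      nlinarith
  have herr : |∑ j, (P j : ℝ) * (p j - q * η j)| ≤ B * β ^ m / T := by
    calc |∑ j, (P j : ℝ) * (p j - q * η j)| ≤ ∑ j, |(P j : ℝ) * (p j - q * η j)| :=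
          abs_sum_le_sum_abs _ _
      _ ≤ ∑ j, |(P j : ℝ)| * (1 / T) := by
          gcongr with j
          rw [abs_mul, abs_sub_comm]
          gcongr
          exact hp j
      _ = (∑ j, |(P j : ℝ)|) / T := by rw [← sum_mul]; ring
      _ ≤ _ := by gcongr
  have hMB : 4 * M * (B * β ^ m) ≤ C₁ * (α * β / γ) ^ m := by
    have h1 : 2 * q * (G * γ ^ m) * M ≤ 1 := le_trans (by gcongr) hM1
    have h2 : (M : ℝ) ≤ 1 / (2 * q * (G * γ ^ m)) := by
      rw [le_div_iff₀ (by positivity)]; linarith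
    calc 4 * M * (B * β ^ m) ≤ 4 * (1 / (2 * q * (G * γ ^ m))) * (B * β ^ m) := by gcongr
      _ = 4 * B * (1 / (2 * q)) * (1 / G) * (β ^ m / γ ^ m) := by field_simp
      _ ≤ 4 * B * (A * α ^ m / α) * (1 / G) * (β ^ m / γ ^ m) := by
          have h3 : 1 / (2 * q : ℝ) ≤ A * α ^ m / α := by
            rw [div_le_div_iff₀ (by positivity) hα]
            linarith
          gcongr
      _ = C₁ * (α * β / γ) ^ m := by
          rw [hC₁, div_pow, mul_pow]; field_simp
  have hsmall : 4 * M * (B * β ^ m) < T := by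
    have h1 : ((α * β / γ) ^ m) ^ (d + 1) * α ^ m ≤ 1 := by
      calc ((α * β / γ) ^ m) ^ (d + 1) * α ^ m = ((α * β / γ) ^ (d + 1) * α) ^ m := by
            rw [mul_pow, ← pow_mul, ← pow_mul, mul_comm m]
        _ ≤ 1 := pow_le_one₀ (by positivity) hκ
    have h2 : ((α * β / γ) ^ m) ^ (d + 1) ≤ 2 * A * q / α := by
      rw [le_div_iff₀ hα]
      calc ((α * β / γ) ^ m) ^ (d + 1) * α
          ≤ ((α * β / γ) ^ m) ^ (d + 1) * (2 * A * q * α ^ m) := by gcongr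
        _ = (((α * β / γ) ^ m) ^ (d + 1) * α ^ m) * (2 * A * q) := by ring
        _ ≤ 1 * (2 * A * q) := by gcongr
        _ = _ := one_mul _
    have h3 : (4 * M * (B * β ^ m)) ^ (d + 1) < (T : ℝ) ^ (d + 1) := by
      calc (4 * M * (B * β ^ m)) ^ (d + 1) ≤ (C₁ * (α * β / γ) ^ m) ^ (d + 1) := by gcongr
        _ = C₁ ^ (d + 1) * ((α * β / γ) ^ m) ^ (d + 1) := mul_pow _ _ _
        _ ≤ C₁ ^ (d + 1) * (2 * A * q / α) := by gcongr
        _ = C₂ * q := by rw [hC₂]; ring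
        _ ≤ C₂ * T ^ d := by gcongr
        _ < T * T ^ d := by gcongr
        _ = (T : ℝ) ^ (d + 1) := by ring
    exact lt_of_pow_lt_pow_left₀ _ (by positivity) h3
  -- the integer `M * (P₀ q + ∑ P_j p_j)` lies strictly between `0` and `1`
  set Z : ℤ := M * (P₀ * q + ∑ j, P j * p j) with hZ
  have hZ' : (Z : ℝ) = M * (q * S) + M * ∑ j, (P j : ℝ) * (p j - q * η j) := by
    rw [hZ, hS]
    push_cast
    simp only [mul_sub, sum_sub_distrib, mul_add, mul_sum]
    have : ∑ x, (M : ℝ) * (P x * (q * η x)) = ∑ x, (M : ℝ) * (q * (P x * η x)) :=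
      sum_congr rfl fun _ _ ↦ by ring
    rw [this]; ring
  have herr' : |M * ∑ j, (P j : ℝ) * (p j - q * η j)| < 1 / 4 := by
    rw [abs_mul, Nat.abs_cast]
    calc M * |∑ j, (P j : ℝ) * (p j - q * η j)| ≤ M * (B * β ^ m / T) := by gcongr
      _ = 4 * M * (B * β ^ m) / T / 4 := by ring
      _ < 1 / 4 := by
          gcongr
          rw [div_lt_one (by linarith)]
          exact hsmall
  rw [abs_lt] at herr'
  have hZ0 : (0 : ℝ) < Z := by rw [hZ']; linarith
  have hZ1 : (Z : ℝ) < 1 := by rw [hZ']; linarith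
  have h1 : 0 < Z := by exact_mod_cast hZ0
  have h2 : Z < 1 := by exact_mod_cast hZ1
  omega

/-- Finitely many reals in the `ℚ`-span of `η₁, …, η_d` are integral combinations of the `η_j`,
up to a common denominator. -/
theorem exists_common_denominator {ι : Type*} (s : Finset ι) (ξ : ι → ℝ) (d : ℕ) (η : Fin d → ℝ)
    (h : ∀ i ∈ s, ξ i ∈ Submodule.span ℚ (Set.range η)) :
    ∃ N : ℕ, 0 < N ∧ ∃ c : ι → Fin d → ℤ, ∀ i ∈ s, N * ξ i = ∑ j, c i j * η j := by
  classical
  have h1 : ∀ i, ∃ c : Fin d → ℚ, i ∈ s → ∑ j, c j • η j = ξ i := by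
    intro i
    by_cases hi : i ∈ s
    · obtain ⟨c, hc⟩ := (Submodule.mem_span_range_iff_exists_fun ℚ).1 (h i hi)
      exact ⟨c, fun _ ↦ hc⟩
    · exact ⟨0, fun h ↦ absurd h hi⟩
  choose c hc using h1
  let N : ℕ := ∏ i ∈ s, ∏ j, (c i j).den
  have hdvd : ∀ i ∈ s, ∀ j, (c i j).den ∣ N := fun i hi j ↦
    (dvd_prod_of_mem _ (mem_univ j)).trans (dvd_prod_of_mem (fun i ↦ ∏ j, (c i j).den) hi)
  refine ⟨N, prod_pos fun i _ ↦ prod_pos fun j _ ↦ (c i j).den_pos,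
    fun i j ↦ (c i j).num * (N / (c i j).den : ℕ), fun i hi ↦ ?_⟩
  rw [← hc i hi, mul_sum]
  refine sum_congr rfl fun j _ ↦ ?_
  obtain ⟨e, he⟩ := hdvd i hi j
  have hden := (c i j).den_pos
  beta_reduce
  rw [he, Nat.mul_div_cancel_left _ hden, Rat.smul_def]
  have hq : ((c i j : ℚ) : ℝ) = (c i j).num / (c i j).den := Rat.cast_def _
  rw [hq]
  have : ((c i j).den : ℝ) ≠ 0 := by exact_mod_cast hden.ne'
  push_cast
  field_simp

/-- `f` is a sum of partial fractions `c_{i,j} / (t + j) ^ (i + 1)` with `i < m` and `j ≤ n`, where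
`D ^ (m - 1 - i) * c_{i,j}` is an integer, and the sum of all `|c_{i,j}|` is at most `B`. -/
def HasPartialFractions (n D m : ℕ) (B : ℝ) (f : ℝ → ℝ) : Prop :=
  ∃ c : ℕ → ℕ → ℝ,
    (∀ t : ℝ, (∀ j ≤ n, t + (j : ℕ) ≠ 0) →
      f t = ∑ i ∈ range m, ∑ j ∈ range (n + 1), c i j / (t + j) ^ (i + 1)) ∧
    (∀ i < m, ∀ j, ∃ z : ℤ, (D : ℝ) ^ (m - 1 - i) * c i j = z) ∧
    ∑ i ∈ range m, ∑ j ∈ range (n + 1), |c i j| ≤ B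

namespace HasPartialFractions

variable {n D m : ℕ} {B : ℝ} {f g : ℝ → ℝ}

theorem congr (hf : HasPartialFractions n D m B f)
    (h : ∀ t : ℝ, (∀ j ≤ n, t + (j : ℕ) ≠ 0) → f t = g t) : HasPartialFractions n D m B g := by
  obtain ⟨c, h1, h2, h3⟩ := hf
  exact ⟨c, fun t ht ↦ (h t ht).symm.trans (h1 t ht), h2, h3⟩

theorem mono {B' : ℝ} (hf : HasPartialFractions n D m B f) (h : B ≤ B') :
    HasPartialFractions n D m B' f := by
  obtain ⟨c, h1, h2, h3⟩ := hf
  exact ⟨c, h1, h2, h3.trans h⟩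

theorem zero : HasPartialFractions n D m 0 fun _ ↦ 0 :=
  ⟨fun _ _ ↦ 0, by simp, fun _ _ _ ↦ ⟨0, by simp⟩, by simp⟩

theorem add {B' : ℝ} (hf : HasPartialFractions n D m B f) (hg : HasPartialFractions n D m B' g) :
    HasPartialFractions n D m (B + B') fun t ↦ f t + g t := by
  obtain ⟨c, h1, h2, h3⟩ := hf
  obtain ⟨e, k1, k2, k3⟩ := hg
  refine ⟨fun i j ↦ c i j + e i j, fun t ht ↦ ?_, fun i hi j ↦ ?_, ?_⟩
  · simp only [h1 t ht, k1 t ht, add_div, sum_add_distrib]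
  · obtain ⟨z, hz⟩ := h2 i hi j
    obtain ⟨w, hw⟩ := k2 i hi j
    exact ⟨z + w, by push_cast; rw [mul_add, hz, hw]⟩
  · refine le_trans ?_ (add_le_add h3 k3)
    simp only [← sum_add_distrib]
    gcongr
    exact abs_add_le _ _

theorem sum {ι : Type*} (s : Finset ι) {F : ι → ℝ → ℝ} {b : ι → ℝ}
    (h : ∀ i ∈ s, HasPartialFractions n D m (b i) (F i)) :
    HasPartialFractions n D m (∑ i ∈ s, b i) fun t ↦ ∑ i ∈ s, F i t := by
  classical
  induction s using Finset.induction_on with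
  | empty => simpa using zero
  | insert a s ha ih =>
    simp only [sum_insert ha]
    exact (h a (mem_insert_self a s)).add (ih fun i hi ↦ h i (mem_insert_of_mem hi))

theorem smul_div_pow (hD : D ≠ 0) (hf : HasPartialFractions n D m B f) (z : ℤ) (s : ℕ) :
    HasPartialFractions n D (m + s) (|z / (D : ℝ) ^ s| * B) fun t ↦ z / (D : ℝ) ^ s * f t := by
  obtain ⟨c, h1, h2, h3⟩ := hf
  have hD' : (D : ℝ) ≠ 0 := by exact_mod_cast hD
  have hext : ∀ g : ℕ → ℕ → ℝ,
      ∑ i ∈ range (m + s), ∑ j ∈ range (n + 1), (if i < m then g i j else 0)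
        = ∑ i ∈ range m, ∑ j ∈ range (n + 1), g i j := by
    intro g
    rw [← sum_subset (range_subset_range.2 (Nat.le_add_right m s))]
    · refine sum_congr rfl fun i hi ↦ sum_congr rfl fun j _ ↦ ?_
      rw [if_pos (mem_range.1 hi)]
    · intro i _ hi
      rw [mem_range] at hi
      simp [hi]
  refine ⟨fun i j ↦ if i < m then z / (D : ℝ) ^ s * c i j else 0, fun t ht ↦ ?_,
    fun i _ j ↦ ?_, ?_⟩
  · beta_reduce
    rw [h1 t ht]
    simp only [mul_sum]
    rw [← hext]
    refine sum_congr rfl fun i _ ↦ sum_congr rfl fun j _ ↦ ?_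
    split_ifs <;> ring
  · by_cases him : i < m
    · obtain ⟨w, hw⟩ := h2 i him j
      refine ⟨z * w, ?_⟩
      beta_reduce
      rw [if_pos him, show m + s - 1 - i = (m - 1 - i) + s by omega, pow_add]
      push_cast
      rw [← hw]
      field_simp
    · exact ⟨0, by simp [him]⟩
  · calc _ = ∑ i ∈ range (m + s), ∑ j ∈ range (n + 1),
          (if i < m then |z / (D : ℝ) ^ s| * |c i j| else 0) := by
          refine sum_congr rfl fun i _ ↦ sum_congr rfl fun j _ ↦ ?_
          beta_reduce
          split_ifs
          · rw [abs_mul]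
          · rw [abs_zero]
      _ = |z / (D : ℝ) ^ s| * ∑ i ∈ range m, ∑ j ∈ range (n + 1), |c i j| := by
          rw [hext]; simp only [mul_sum]
      _ ≤ _ := by gcongr

theorem inv_pow (i : ℕ) {j : ℕ} (hj : j ≤ n) :
    HasPartialFractions n D (i + 1) 1 fun t ↦ 1 / (t + j) ^ (i + 1) := by
  refine ⟨fun i' j' ↦ if i' = i ∧ j' = j then 1 else 0, fun t _ ↦ ?_, fun i' hi' j' ↦ ?_, ?_⟩
  · rw [sum_eq_single i, sum_eq_single j]
    · simp
    · intro b _ hb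
      simp [hb]
    · intro h
      exact absurd (mem_range.2 (by omega)) h
    · intro b _ hb
      simp [hb]
    · simp
  · by_cases h : i' = i ∧ j' = j
    · exact ⟨1, by simp [h.1, h.2]⟩
    · exact ⟨0, by simp [h]⟩
  · rw [sum_eq_single i, sum_eq_single j]
    · simp
    · intro b _ hb
      simp [hb]
    · intro h
      exact absurd (mem_range.2 (by omega)) h
    · intro b _ hb
      simp [hb]
    · simp

theorem inv_pow_mul_inv (hD : D ≠ 0) (hdvd : ∀ d, 1 ≤ d → d ≤ n → d ∣ D) (i : ℕ) {j k : ℕ}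
    (hj : j ≤ n) (hk : k ≤ n) :
    HasPartialFractions n D (i + 2) (i + 2) fun t ↦ 1 / (t + j) ^ (i + 1) * (1 / (t + k)) := by
  have hD' : (D : ℝ) ≠ 0 := by exact_mod_cast hD
  rcases eq_or_ne j k with rfl | hjk
  · refine ((inv_pow (i + 1) hj).mono ?_).congr fun t _ ↦ ?_
    · have : (0 : ℝ) ≤ i := by positivity
      linarith
    · rw [pow_succ, one_div_mul_one_div]
  obtain ⟨z, hz, hz1⟩ : ∃ z : ℤ, z / (D : ℝ) ^ 1 = 1 / ((k : ℝ) - j) ∧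
      |z / (D : ℝ) ^ 1| ≤ 1 := by
    have hne : (k : ℤ) - j ≠ 0 := by omega
    have hd : ((k : ℤ) - j) ∣ D := by
      rw [← Int.natAbs_dvd, Int.natCast_dvd_natCast]
      exact hdvd _ (by omega) (by omega)
    obtain ⟨z, hz⟩ := hd
    have hne' : (k : ℝ) - j ≠ 0 := by exact_mod_cast hne
    have hz' : (D : ℝ) = (k - j) * z := by exact_mod_cast hz
    have h1 : (z : ℝ) / (D : ℝ) ^ 1 = 1 / ((k : ℝ) - j) := by
      rw [pow_one, div_eq_div_iff hD' hne', hz']; ring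
    refine ⟨z, h1, ?_⟩
    rw [h1, abs_div, abs_one]
    apply div_le_one_of_le₀ _ (abs_nonneg _)
    have : (1 : ℤ) ≤ |(k : ℤ) - j| := Int.one_le_abs hne
    exact_mod_cast this
  have hne' : (k : ℝ) - j ≠ 0 := by
    rw [sub_ne_zero]; exact_mod_cast hjk.symm
  induction i with
  | zero =>
    have h1 := (inv_pow (n := n) (D := D) 0 hj).add
      ((inv_pow (n := n) (D := D) 0 hk).smul_div_pow hD (-1) 0)
    have h2 := h1.smul_div_pow hD z 1
    refine (h2.mono ?_).congr fun t ht ↦ ?_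
    · norm_num at hz1 ⊢
      linarith
    · rw [hz]
      have := ht j hj
      have := ht k hk
      field_simp
      push_cast
      ring
  | succ i ih =>
    have h1 := (inv_pow (n := n) (D := D) (i + 1) hj).add (ih.smul_div_pow hD (-1) 0)
    have h2 := h1.smul_div_pow hD z 1
    refine (h2.mono ?_).congr fun t ht ↦ ?_
    · calc _ ≤ 1 * (1 + |((-1 : ℤ) : ℝ) / (D : ℝ) ^ 0| * (i + 2)) := by gcongr
        _ = _ := by push_cast; norm_num; ring
    · rw [hz]
      have := ht j hj
      have := ht k hk
      field_simp
      push_cast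
      ring

theorem mul_inv (hD : D ≠ 0) (hdvd : ∀ d, 1 ≤ d → d ≤ n → d ∣ D)
    (hf : HasPartialFractions n D m B f) {k : ℕ} (hk : k ≤ n) :
    HasPartialFractions n D (m + 1) ((m + 1) * B) fun t ↦ f t * (1 / (t + k)) := by
  obtain ⟨c, h1, h2, h3⟩ := hf
  have hD' : (D : ℝ) ≠ 0 := by exact_mod_cast hD
  have key : ∀ i ∈ range m, ∀ j ∈ range (n + 1), HasPartialFractions n D (m + 1)
      ((m + 1) * |c i j|) fun t ↦ c i j / (t + j) ^ (i + 1) * (1 / (t + k)) := by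
    intro i hi j hj
    rw [mem_range] at hi hj
    obtain ⟨z, hz⟩ := h2 i hi j
    have hc : c i j = z / (D : ℝ) ^ (m - 1 - i) := by
      rw [eq_div_iff (pow_ne_zero _ hD'), ← hz]; ring
    have := (inv_pow_mul_inv hD hdvd i (Nat.lt_succ_iff.1 hj) hk).smul_div_pow hD z (m - 1 - i)
    rw [show i + 2 + (m - 1 - i) = m + 1 by omega, ← hc] at this
    refine (this.mono ?_).congr fun t _ ↦ by ring
    rw [mul_comm]
    have : (i : ℝ) + 2 ≤ m + 1 := by
      have : (i : ℝ) + 1 ≤ m := by exact_mod_cast hi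
      linarith
    exact mul_le_mul_of_nonneg_right this (abs_nonneg _)
  refine ((sum _ fun i hi ↦ sum _ (key i hi)).mono ?_).congr fun t ht ↦ ?_
  · simp only [← mul_sum]
    gcongr
  · rw [h1 t ht, sum_mul]
    simp only [sum_mul]

theorem mul (hD : D ≠ 0) (hdvd : ∀ d, 1 ≤ d → d ≤ n → d ∣ D) {W : ℝ}
    (hf : HasPartialFractions n D m (m.factorial * B) f) (hg : HasPartialFractions n D 1 W g)
    (hB : 0 ≤ B) :
    HasPartialFractions n D (m + 1) ((m + 1).factorial * (B * W)) fun t ↦ f t * g t := by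
  obtain ⟨e, k1, k2, k3⟩ := hg
  have key : ∀ k ∈ range (n + 1), HasPartialFractions n D (m + 1)
      ((m + 1).factorial * B * |e 0 k|) fun t ↦ e 0 k * (f t * (1 / (t + k))) := by
    intro k hk
    rw [mem_range] at hk
    obtain ⟨z, hz⟩ := k2 0 one_pos k
    have := (hf.mul_inv hD hdvd (Nat.lt_succ_iff.1 hk)).smul_div_pow hD z 0
    simp only [pow_zero, one_mul, div_one, add_zero, Nat.sub_self] at this hz
    rw [← hz] at this
    refine this.mono (le_of_eq ?_)
    rw [Nat.factorial_succ]
    push_cast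
    ring
  refine ((sum _ key).mono ?_).congr fun t ht ↦ ?_
  · rw [← mul_sum, ← mul_assoc]
    simp only [range_one, sum_singleton] at k3
    gcongr
  · rw [k1 t ht]
    simp only [range_one, sum_singleton, mul_sum]
    refine sum_congr rfl fun k _ ↦ ?_
    rw [zero_add, pow_one]
    ring

theorem mul_prod (hD : D ≠ 0) (hdvd : ∀ d, 1 ≤ d → d ≤ n → d ∣ D) {W : ℝ}
    (hf : HasPartialFractions n D m (m.factorial * B) f) (hB : 0 ≤ B) (hW : 0 ≤ W)
    {F : ℕ → ℝ → ℝ} (s : ℕ) (hF : ∀ l < s, HasPartialFractions n D 1 W (F l)) :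
    HasPartialFractions n D (m + s) ((m + s).factorial * (B * W ^ s))
      fun t ↦ f t * ∏ l ∈ range s, F l t := by
  induction s with
  | zero => simpa using hf
  | succ s ih =>
    have := (ih fun l hl ↦ hF l (hl.trans (Nat.lt_succ_self s))).mul hD hdvd
      (hF s (Nat.lt_succ_self s)) (by positivity)
    rw [mul_assoc, ← pow_succ] at this
    simp only [prod_range_succ, ← mul_assoc] at this ⊢
    exact this

end HasPartialFractions

theorem pow_self_le_factorial_mul (n : ℕ) : (n : ℝ) ^ n ≤ n.factorial * 3 ^ n := by
  have h1 := Real.pow_div_factorial_le_exp (x := (n : ℝ)) (by positivity) n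
  have h2 : Real.exp n ≤ 3 ^ n := by
    rw [← mul_one (n : ℝ), Real.exp_nat_mul]
    gcongr
    exact Real.exp_one_lt_d9.le.trans (by norm_num)
  have h3 : (0 : ℝ) < n.factorial := by exact_mod_cast n.factorial_pos
  rw [div_le_iff₀ h3] at h1
  nlinarith

theorem prod_erase_range_sub {j n : ℕ} (hj : j ≤ n) :
    ∏ i ∈ (range (n + 1)).erase j, ((i : ℝ) - j) = (-1) ^ j * j.factorial * (n - j).factorial := by
  obtain ⟨k, rfl⟩ := Nat.exists_eq_add_of_le hj
  have h1 : ∏ i ∈ (range (j + k + 1)).erase j, ((i : ℝ) - j)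
      = ∏ i ∈ range (j + 1 + k), if i = j then 1 else ((i : ℝ) - j) := by
    rw [show j + 1 + k = j + k + 1 by ring,
      ← mul_prod_erase (range (j + k + 1)) _ (mem_range.2 (show j < j + k + 1 by omega)),
      if_pos rfl, one_mul]
    refine prod_congr rfl fun i hi ↦ ?_
    rw [if_neg (ne_of_mem_erase hi)]
  rw [h1, prod_range_add, prod_range_succ, if_pos rfl, mul_one, Nat.add_sub_cancel_left]
  congr 1
  · rw [← prod_range_add_one_eq_factorial, ← prod_range_reflect, Nat.cast_prod]
    have : ((-1 : ℝ)) ^ j = ∏ _i ∈ range j, (-1 : ℝ) := by simp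
    rw [this, ← prod_mul_distrib]
    refine prod_congr rfl fun i hi ↦ ?_
    rw [mem_range] at hi
    rw [if_neg (by omega), Nat.sub_sub, Nat.cast_sub (by omega)]
    push_cast
    ring
  · rw [← prod_range_add_one_eq_factorial, Nat.cast_prod]
    refine prod_congr rfl fun i _ ↦ ?_
    rw [if_neg (by omega)]
    push_cast
    ring

namespace HasPartialFractions

open Polynomial in
theorem of_polynomial {n D : ℕ} (N : ℝ[X]) (hN : N.degree < (n + 1 : ℕ)) {Z : ℝ}
    (hz_int : ∀ j ≤ n, ∃ z : ℤ, N.eval (-(j : ℝ)) = n.factorial * z)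
    (hle : ∀ j ≤ n, |N.eval (-(j : ℝ))| ≤ n.factorial * Z) :
    HasPartialFractions n D 1 (2 ^ n * Z) fun t ↦ N.eval t / ∏ j ∈ range (n + 1), (t + j) := by
  have hn : (n.factorial : ℝ) ≠ 0 := by exact_mod_cast n.factorial_ne_zero
  let v : ℕ → ℝ := fun j ↦ -j
  have hw : ∀ j ≤ n, Lagrange.nodalWeight (range (n + 1)) v j
      = (-1) ^ j * n.choose j / n.factorial := by
    intro j hj
    have h1 : Lagrange.nodalWeight (range (n + 1)) v j
        = (∏ i ∈ (range (n + 1)).erase j, ((i : ℝ) - j))⁻¹ := by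
      rw [Lagrange.nodalWeight, ← prod_inv_distrib]
      refine prod_congr rfl fun i _ ↦ ?_
      simp only [v]
      ring
    have h2 : (n.choose j : ℝ) * j.factorial * (n - j).factorial = n.factorial := by
      exact_mod_cast Nat.choose_mul_factorial_mul_factorial hj
    have h3 : (j.factorial : ℝ) ≠ 0 := by exact_mod_cast j.factorial_ne_zero
    have h4 : ((n - j).factorial : ℝ) ≠ 0 := by exact_mod_cast (n - j).factorial_ne_zero
    rw [h1, prod_erase_range_sub hj, eq_div_iff hn, ← h2]
    have h5 : ((-1 : ℝ) ^ j) * (-1) ^ j = 1 := by rw [← mul_pow]; norm_num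
    have h6 : ((-1 : ℝ) ^ j) ≠ 0 := by positivity
    field_simp
    rw [sq, h5, one_mul]
  have hc : ∀ j ≤ n, N.eval (v j) * Lagrange.nodalWeight (range (n + 1)) v j
      = (-1) ^ j * n.choose j * (N.eval (v j) / n.factorial) := by
    intro j hj
    rw [hw j hj]
    ring
  refine ⟨fun _ j ↦ if j ≤ n then
      N.eval (v j) * Lagrange.nodalWeight (range (n + 1)) v j else 0, fun t ht ↦ ?_,
    fun i hi j ↦ ?_, ?_⟩
  · have hinj : Set.InjOn v (range (n + 1)) := by
      intro i _ j _ h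
      simpa [v] using h
    have hprod : ∏ j ∈ range (n + 1), (t + j) ≠ 0 :=
      prod_ne_zero_iff.2 fun j hj ↦ ht j (Nat.lt_succ_iff.1 (mem_range.1 hj))
    have h1 := Lagrange.eq_interpolate (f := N) hinj (by simpa using hN)
    have h2 := Lagrange.eval_interpolate_not_at_node (s := range (n + 1)) (v := v) (x := t)
      (fun i ↦ N.eval (v i)) (fun i hi h ↦ ht i (Nat.lt_succ_iff.1 (mem_range.1 hi)) (by
        rw [h]; simp [v]))
    rw [← h1, Lagrange.eval_nodal] at h2
    simp only [v, sub_neg_eq_add] at h2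
    rw [div_eq_iff hprod, h2, mul_comm]
    simp only [range_one, sum_singleton, zero_add, pow_one]
    congr 1
    refine sum_congr rfl fun j hj ↦ ?_
    rw [if_pos (Nat.lt_succ_iff.1 (mem_range.1 hj))]
    simp only [v]
    ring
  · by_cases hj : j ≤ n
    · obtain ⟨z, hz⟩ := hz_int j hj
      refine ⟨(-1) ^ j * n.choose j * z, ?_⟩
      beta_reduce
      rw [if_pos hj, hc j hj, hz]
      push_cast
      field_simp
      simp
    · exact ⟨0, by simp [hj]⟩
  · simp only [range_one, sum_singleton]
    calc _ ≤ ∑ j ∈ range (n + 1), (n.choose j : ℝ) * Z := by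
          refine sum_le_sum fun j hj ↦ ?_
          have hj' := Nat.lt_succ_iff.1 (mem_range.1 hj)
          rw [if_pos hj', hc j hj', abs_mul, abs_mul, abs_pow, abs_neg, abs_one, one_pow, one_mul,
            Nat.abs_cast, abs_div, Nat.abs_cast]
          gcongr
          rw [div_le_iff₀' (by positivity)]
          exact hle j hj'
      _ = 2 ^ n * Z := by
          rw [← sum_mul]
          congr 1
          exact_mod_cast Nat.sum_range_choose n

theorem factorial_div (n D : ℕ) :
    HasPartialFractions n D 1 (2 ^ n) fun t ↦ n.factorial / ∏ j ∈ range (n + 1), (t + j) := by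
  have := of_polynomial (n := n) (D := D) (Polynomial.C (n.factorial : ℝ)) (Z := 1)
    (Polynomial.degree_C_le.trans_lt (by exact_mod_cast n.succ_pos))
    (fun j _ ↦ ⟨1, by simp⟩) (fun j _ ↦ by simp)
  simpa using this

theorem prod_div (n D : ℕ) (x : ℤ) {Y : ℝ} (hY : 0 ≤ Y)
    (h : ∀ j ≤ n, ∀ u < n, |(x : ℝ) - j + u| ≤ Y * n) :
    HasPartialFractions n D 1 (2 ^ n * (3 * Y) ^ n)
      fun t ↦ (∏ u ∈ range n, (t + x + u)) / ∏ j ∈ range (n + 1), (t + j) := by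
  have := of_polynomial (n := n) (D := D)
    (∏ u ∈ range n, (Polynomial.X + Polynomial.C ((x : ℝ) + u))) (Z := (3 * Y) ^ n) ?_ ?_ ?_
  · refine this.congr fun t _ ↦ ?_
    rw [Polynomial.eval_prod]
    simp [add_assoc]
  · rw [Polynomial.degree_prod]
    simp only [Polynomial.degree_X_add_C, sum_const, card_range, nsmul_eq_mul, mul_one]
    exact_mod_cast n.lt_succ_self
  · intro j _
    obtain ⟨z, hz⟩ := Nat.factorial_coe_dvd_prod n (-j + x)
    refine ⟨z, ?_⟩
    rw [Polynomial.eval_prod]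
    have hz' := congrArg (Int.cast (R := ℝ)) hz
    push_cast at hz'
    rw [← hz']
    simp [add_assoc]
  · intro j hj
    rw [Polynomial.eval_prod, abs_prod]
    calc _ ≤ ∏ _u ∈ range n, Y * n := by
          gcongr with u hu
          rw [mem_range] at hu
          have := h j hj u hu
          simp only [Polynomial.eval_add, Polynomial.eval_X, Polynomial.eval_C]
          rwa [show -(j : ℝ) + (x + u) = x - j + u by ring]
      _ = Y ^ n * (n : ℝ) ^ n := by simp [mul_pow]
      _ ≤ Y ^ n * (n.factorial * 3 ^ n) := by
          gcongr
          exact pow_self_le_factorial_mul n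
      _ = n.factorial * (3 * Y) ^ n := by rw [mul_pow]; ring

end HasPartialFractions

/-- The Ball–Rivoal rational function
`n!^(a-2r) (t-rn)_{rn} (t+n+1)_{rn} / (t)_{n+1}^a`, where `a = 2r² + 4r + 1`. -/
noncomputable def ballRivoal (n r : ℕ) (t : ℝ) : ℝ :=
  (n.factorial / ∏ j ∈ range (n + 1), (t + j)) ^ (2 * r ^ 2 + 2 * r + 1) *
    (∏ l ∈ range r,
      (∏ u ∈ range n, (t + (-((l + 1) * n : ℕ) : ℤ) + u)) / ∏ j ∈ range (n + 1), (t + j)) *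
    ∏ l ∈ range r,
      (∏ u ∈ range n, (t + ((l + 1) * n + 1 : ℕ) + u)) / ∏ j ∈ range (n + 1), (t + j)

theorem ballRivoal_hasPartialFractions {n D : ℕ} (r : ℕ) (hD : D ≠ 0)
    (hdvd : ∀ d, 1 ≤ d → d ≤ n → d ∣ D) :
    HasPartialFractions n D (2 * (r ^ 2 + 2 * r) + 1) ((2 * (r ^ 2 + 2 * r) + 1).factorial *
      (2 ^ (2 * (r ^ 2 + 2 * r) + 1) * (3 * (r + 1)) ^ (2 * r)) ^ n) (ballRivoal n r) := by
  have h0 := HasPartialFractions.factorial_div n D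
  have h1 : HasPartialFractions n D 1 ((1 : ℕ).factorial * 2 ^ n)
      (fun t ↦ n.factorial / ∏ j ∈ range (n + 1), (t + j)) := by simpa using h0
  have hcast : ∀ l < r, ((l : ℝ) + 1) * n + n ≤ (r + 1) * n := by
    intro l hl
    have : (l : ℝ) + 1 ≤ r := by exact_mod_cast hl
    have : (0 : ℝ) ≤ n := by positivity
    nlinarith
  have h2 := h1.mul_prod hD hdvd (W := 2 ^ n) (by positivity) (by positivity)
    (2 * r ^ 2 + 2 * r) (fun _ _ ↦ h0)
  have h3 := h2.mul_prod hD hdvd (W := 2 ^ n * (3 * (r + 1)) ^ n) (by positivity) (by positivity) r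
    fun l hl ↦ HasPartialFractions.prod_div n D (-((l + 1) * n : ℕ) : ℤ) (Y := r + 1)
      (by positivity) fun j hj u hu ↦ by
        have := hcast l hl
        have hj' : (j : ℝ) ≤ n := by exact_mod_cast hj
        have hu' : (u : ℝ) ≤ n := by exact_mod_cast hu.le
        have : (0 : ℝ) ≤ (l + 1) * n := by positivity
        have : (0 : ℝ) ≤ j := by positivity
        have : (0 : ℝ) ≤ u := by positivity
        push_cast
        rw [abs_le]
        constructor <;> nlinarith
  have h4 := h3.mul_prod hD hdvd (W := 2 ^ n * (3 * (r + 1)) ^ n) (by positivity) (by positivity) r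
    fun l hl ↦ HasPartialFractions.prod_div n D (((l + 1) * n + 1 : ℕ) : ℤ) (Y := r + 1)
      (by positivity) fun j hj u hu ↦ by
        have := hcast l hl
        have hj' : (j : ℝ) ≤ n := by exact_mod_cast hj
        have hu' : (u : ℝ) + 1 ≤ n := by exact_mod_cast hu
        have : (0 : ℝ) ≤ (l + 1) * n := by positivity
        have : (0 : ℝ) ≤ j := by positivity
        have : (0 : ℝ) ≤ u := by positivity
        push_cast
        rw [abs_le]
        constructor <;> nlinarith
  have ha : 1 + (2 * r ^ 2 + 2 * r) + r + r = 2 * (r ^ 2 + 2 * r) + 1 := by ring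
  rw [ha] at h4
  refine (h4.mono (le_of_eq ?_)).congr fun t _ ↦ ?_
  · congr 1
    rw [← ha]
    generalize (3 * (r + 1) : ℝ) = w
    generalize 2 * r ^ 2 + 2 * r = q
    simp only [mul_pow, ← pow_mul]
    ring
  · rw [ballRivoal, pow_succ' _ (2 * r ^ 2 + 2 * r), prod_const, card_range]
    push_cast
    ring

theorem prod_range_reflect_neg (n : ℕ) (x y : ℝ) (h : x + y = 1 - n) :
    ∏ u ∈ range n, (x + u) = (-1) ^ n * ∏ u ∈ range n, (y + u) := by
  have : ((-1 : ℝ)) ^ n = ∏ _i ∈ range n, (-1 : ℝ) := by simp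
  rw [← prod_range_reflect, this, ← prod_mul_distrib]
  refine prod_congr rfl fun u hu ↦ ?_
  rw [mem_range] at hu
  rw [Nat.sub_sub, Nat.cast_sub (by omega)]
  push_cast
  linarith

theorem ballRivoal_symm {n : ℕ} (hn : Even n) (r : ℕ) (t : ℝ) :
    ballRivoal n r (-n - t) = -ballRivoal n r t := by
  have hP : ∏ j ∈ range (n + 1), (-n - t + j : ℝ) = -∏ j ∈ range (n + 1), (t + j) := by
    rw [prod_range_reflect_neg (n + 1) (-n - t) t (by push_cast; ring), hn.add_one.neg_one_pow]
    ring
  have h1 : ∀ l, ∏ u ∈ range n, (-n - t + ((-((l + 1) * n : ℕ) : ℤ) : ℝ) + u)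
      = ∏ u ∈ range n, (t + ((l + 1) * n + 1 : ℕ) + u) := by
    intro l
    rw [prod_range_reflect_neg n _ (t + ((l + 1) * n + 1 : ℕ)) (by push_cast; ring),
      hn.neg_one_pow, one_mul]
  have h2 : ∀ l, ∏ u ∈ range n, (-n - t + ((l + 1) * n + 1 : ℕ) + u)
      = ∏ u ∈ range n, (t + ((-((l + 1) * n : ℕ) : ℤ) : ℝ) + u) := by
    intro l
    rw [prod_range_reflect_neg n _ (t + ((-((l + 1) * n : ℕ) : ℤ) : ℝ)) (by push_cast; ring),
      hn.neg_one_pow, one_mul]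
  have hodd : Odd (2 * r ^ 2 + 2 * r + 1) := ⟨r ^ 2 + r, by ring⟩
  simp only [ballRivoal, hP, h1, h2, div_neg, prod_neg, hodd.neg_pow, card_range]
  have h5 : ((-1 : ℝ) ^ r) * (-1) ^ r = 1 := by rw [← mul_pow]; norm_num
  linear_combination (-(n.factorial / ∏ j ∈ range (n + 1), (t + j)) ^ (2 * r ^ 2 + 2 * r + 1) *
    (∏ l ∈ range r,
      (∏ u ∈ range n, (t + (-((l + 1) * n : ℕ) : ℤ) + u)) / ∏ j ∈ range (n + 1), (t + j)) *
    ∏ l ∈ range r,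
      (∏ u ∈ range n, (t + ((l + 1) * n + 1 : ℕ) + u)) / ∏ j ∈ range (n + 1), (t + j)) * h5

theorem ballRivoal_eq_zero {n r k : ℕ} (hk : k < r * n) : ballRivoal n r (k + 1) = 0 := by
  have hn : 0 < n := Nat.pos_of_ne_zero fun h ↦ by simp [h] at hk
  have hl : k / n < r := Nat.div_lt_of_lt_mul (by rwa [mul_comm])
  have hu : n - 1 - k % n < n := by omega
  have hmod := Nat.mod_lt k hn
  have hdm := Nat.div_add_mod k n
  have : ∏ l ∈ range r, (∏ u ∈ range n, ((k + 1 : ℝ) + (-((l + 1) * n : ℕ) : ℤ) + u)) /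
      ∏ j ∈ range (n + 1), ((k + 1 : ℝ) + j) = 0 := by
    refine prod_eq_zero (mem_range.2 hl) ?_
    rw [prod_eq_zero (mem_range.2 hu), zero_div]
    have h1 : ((n - 1 - k % n : ℕ) : ℤ) = n - 1 - (k % n : ℕ) := by omega
    have h2 : (k : ℤ) = n * (k / n : ℕ) + (k % n : ℕ) := by exact_mod_cast hdm.symm
    have h3 : ((k : ℤ) + 1) + (-(((k / n : ℕ) + 1) * n : ℕ) : ℤ) + (n - 1 - k % n : ℕ) = 0 := by
      rw [h1]
      push_cast at h2 ⊢
      linarith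
    exact_mod_cast h3
  rw [ballRivoal, this, mul_zero, zero_mul]

theorem ballRivoal_bounds {n r : ℕ} (hr : 1 ≤ r) (k : ℕ) :
    0 ≤ ballRivoal n r (k + 1) ∧ ballRivoal n r (k + 1) ≤
      ((1 / r) ^ (2 * r ^ 2 + 2 * r + 1) * 3 ^ r) ^ n * (1 / (k + 1 : ℝ) ^ 2) := by
  have hr' : (1 : ℝ) ≤ r := by exact_mod_cast hr
  rcases lt_or_ge k (r * n) with hk | hk
  · rw [ballRivoal_eq_zero hk]
    exact ⟨le_rfl, by positivity⟩
  have hk' : (r * n : ℝ) ≤ k := by exact_mod_cast hk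
  set x : ℝ := k + 1 with hx
  have hx1 : 1 ≤ x := by
    have : (0 : ℝ) ≤ k := by positivity
    linarith
  have hx0 : 0 < x := by linarith
  have hn0 : (0 : ℝ) ≤ n := by positivity
  have hP : x ^ (n + 1) ≤ ∏ j ∈ range (n + 1), (x + j) := by
    calc x ^ (n + 1) = ∏ _j ∈ range (n + 1), x := by simp
      _ ≤ _ := by
        gcongr with j
        have : (0 : ℝ) ≤ j := by positivity
        linarith
  have hdiv : ∀ N c : ℝ, 0 ≤ N → N ≤ (c * x) ^ n →
      0 ≤ N / ∏ j ∈ range (n + 1), (x + j) ∧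
        N / ∏ j ∈ range (n + 1), (x + j) ≤ c ^ n * (1 / x) := by
    intro N c hN0 hN
    refine ⟨by positivity, ?_⟩
    calc N / ∏ j ∈ range (n + 1), (x + j) ≤ (c * x) ^ n / x ^ (n + 1) := by
          gcongr
          exact hN0.trans hN
      _ = c ^ n * (1 / x) := by rw [mul_pow, pow_succ]; field_simp
  have h1 := hdiv n.factorial (1 / r) (by positivity) (by
    calc (n.factorial : ℝ) ≤ (n : ℝ) ^ n := by exact_mod_cast n.factorial_le_pow
      _ ≤ _ := by
        gcongr
        rw [one_div_mul_eq_div, le_div_iff₀ (by linarith)]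
        linarith)
  have h2 : ∀ l ∈ range r, 0 ≤ (∏ u ∈ range n, (x + (-((l + 1) * n : ℕ) : ℤ) + u)) /
      ∏ j ∈ range (n + 1), (x + j) ∧ (∏ u ∈ range n, (x + (-((l + 1) * n : ℕ) : ℤ) + u)) /
      ∏ j ∈ range (n + 1), (x + j) ≤ 1 ^ n * (1 / x) := by
    intro l hl
    have hl' : (l : ℝ) + 1 ≤ r := by exact_mod_cast mem_range.1 hl
    have h3 : ∀ u ∈ range n, 0 ≤ x + (-((l + 1) * n : ℕ) : ℤ) + u := by
      intro u _
      have : (0 : ℝ) ≤ u := by positivity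
      push_cast
      nlinarith
    refine hdiv _ 1 (prod_nonneg h3) ?_
    calc _ ≤ ∏ _u ∈ range n, (1 * x) := by
          refine prod_le_prod h3 fun u hu ↦ ?_
          have : (u : ℝ) ≤ n := by exact_mod_cast (mem_range.1 hu).le
          have : (0 : ℝ) ≤ l := by positivity
          push_cast
          nlinarith
      _ = _ := by simp
  have h3 : ∀ l ∈ range r, 0 ≤ (∏ u ∈ range n, (x + ((l + 1) * n + 1 : ℕ) + u)) /
      ∏ j ∈ range (n + 1), (x + j) ∧ (∏ u ∈ range n, (x + ((l + 1) * n + 1 : ℕ) + u)) /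
      ∏ j ∈ range (n + 1), (x + j) ≤ 3 ^ n * (1 / x) := by
    intro l hl
    have hl' : (l : ℝ) + 1 ≤ r := by exact_mod_cast mem_range.1 hl
    refine hdiv _ 3 (by positivity) ?_
    calc _ ≤ ∏ _u ∈ range n, (3 * x) := by
          gcongr with u hu
          have : (u : ℝ) + 1 ≤ n := by exact_mod_cast mem_range.1 hu
          push_cast
          nlinarith
      _ = _ := by simp
  refine ⟨mul_nonneg (mul_nonneg (pow_nonneg h1.1 _) (prod_nonneg fun l hl ↦ (h2 l hl).1))
    (prod_nonneg fun l hl ↦ (h3 l hl).1), ?_⟩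
  have hinv : 1 / x ≤ 1 := by rw [div_le_one hx0]; exact hx1
  calc ballRivoal n r x ≤ ((1 / r) ^ n * (1 / x)) ^ (2 * r ^ 2 + 2 * r + 1) *
        (∏ _l ∈ range r, (1 ^ n * (1 / x))) * ∏ _l ∈ range r, (3 ^ n * (1 / x)) := by
        rw [ballRivoal]
        refine mul_le_mul (mul_le_mul (pow_le_pow_left₀ h1.1 h1.2 _)
          (prod_le_prod (fun l hl ↦ (h2 l hl).1) fun l hl ↦ (h2 l hl).2)
          (prod_nonneg fun l hl ↦ (h2 l hl).1) (by positivity))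
          (prod_le_prod (fun l hl ↦ (h3 l hl).1) fun l hl ↦ (h3 l hl).2)
          (prod_nonneg fun l hl ↦ (h3 l hl).1) (by positivity)
    _ = ((1 / r) ^ (2 * r ^ 2 + 2 * r + 1) * 3 ^ r) ^ n *
        (1 / x) ^ (2 * r ^ 2 + 2 * r + 1 + r + r) := by
        simp only [prod_const, card_range, one_pow, one_mul, mul_pow, ← pow_mul, pow_add]
        ring
    _ ≤ ((1 / r) ^ (2 * r ^ 2 + 2 * r + 1) * 3 ^ r) ^ n * (1 / x) ^ 2 := by
        gcongr _ * ?_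
        exact pow_le_pow_of_le_one (by positivity) hinv (by nlinarith)
    _ = _ := by rw [one_div_pow x 2]

theorem factorial_div_prod_ge (n r : ℕ) :
    1 / (r + 2) * (1 / (6 * (r + 2))) ^ n ≤
      (n.factorial : ℝ) / ∏ j ∈ range (n + 1), ((r * n : ℕ) + 1 + j : ℝ) := by
  rcases Nat.eq_zero_or_pos n with rfl | hn
  · have : (1 : ℝ) ≤ r + 2 := by
      have : (0 : ℝ) ≤ r := by positivity
      linarith
    simpa using inv_le_one_of_one_le₀ this
  have hn1 : (1 : ℝ) ≤ n := by exact_mod_cast hn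
  have hP : ∏ j ∈ range (n + 1), ((r * n : ℕ) + 1 + j : ℝ) ≤ ((r + 2) * n) ^ (n + 1) := by
    calc _ ≤ ∏ _j ∈ range (n + 1), ((r + 2) * n : ℝ) := by
          gcongr with j hj
          have : (j : ℝ) ≤ n := by exact_mod_cast Nat.lt_succ_iff.1 (mem_range.1 hj)
          push_cast
          linarith
      _ = _ := by simp
  have hfac : (n : ℝ) ^ n ≤ n.factorial * 3 ^ n := pow_self_le_factorial_mul n
  have h2 : (n : ℝ) ≤ 2 ^ n := by exact_mod_cast n.lt_two_pow_self.le
  have hP0 : 0 < ∏ j ∈ range (n + 1), ((r * n : ℕ) + 1 + j : ℝ) := by positivity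
  rw [le_div_iff₀ hP0]
  calc _ ≤ 1 / (r + 2) * (1 / (6 * (r + 2))) ^ n * ((r + 2) * n : ℝ) ^ (n + 1) := by gcongr
    _ = (1 / 6) ^ n * n * (n : ℝ) ^ n := by
        rw [mul_pow, pow_succ (r + 2 : ℝ), pow_succ (n : ℝ), one_div_pow, one_div_pow, mul_pow]
        field_simp
    _ ≤ (1 / 6) ^ n * 2 ^ n * (n.factorial * 3 ^ n) := by gcongr
    _ = n.factorial * (1 / 6 * 2 * 3) ^ n := by rw [mul_pow, mul_pow]; ring
    _ = n.factorial := by norm_num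

theorem ballRivoal_ge (n r : ℕ) :
    (1 / (r + 2)) ^ (2 * (r ^ 2 + 2 * r) + 1) *
      ((1 / (6 * (r + 2))) ^ (2 * (r ^ 2 + 2 * r) + 1)) ^ n ≤
      ballRivoal n r ((r * n : ℕ) + 1) := by
  have h0 := factorial_div_prod_ge n r
  set P : ℝ := ∏ j ∈ range (n + 1), ((r * n : ℕ) + 1 + j : ℝ) with hP
  have hP0 : 0 < P := by positivity
  have hblock : ∀ y : ℝ, 1 ≤ y → n.factorial / P ≤ (∏ u ∈ range n, (y + u)) / P := by
    intro y hy
    gcongr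
    rw [← prod_range_add_one_eq_factorial, Nat.cast_prod]
    gcongr with u
    push_cast
    linarith
  have hn0 : (0 : ℝ) ≤ n := by positivity
  calc _ = (1 / (r + 2) * (1 / (6 * (r + 2))) ^ n : ℝ) ^ (2 * (r ^ 2 + 2 * r) + 1) := by
        rw [mul_pow, ← pow_mul, ← pow_mul, mul_comm n]
    _ ≤ (n.factorial / P) ^ (2 * (r ^ 2 + 2 * r) + 1) := by gcongr
    _ = (n.factorial / P) ^ (2 * r ^ 2 + 2 * r + 1) * (∏ _l ∈ range r, n.factorial / P) *
        ∏ _l ∈ range r, n.factorial / P := by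
        rw [prod_const, card_range, ← pow_add, ← pow_add]
        congr 1
        ring
    _ ≤ _ := by
        rw [ballRivoal, ← hP]
        have h1 : ∀ l ∈ range r, n.factorial / P ≤ (∏ u ∈ range n,
            ((r * n : ℕ) + 1 + (-((l + 1) * n : ℕ) : ℤ) + u : ℝ)) / P := by
          intro l hl
          refine hblock _ ?_
          have : (l : ℝ) + 1 ≤ r := by exact_mod_cast mem_range.1 hl
          push_cast
          nlinarith
        have h2 : ∀ l ∈ range r, n.factorial / P ≤ (∏ u ∈ range n,
            ((r * n : ℕ) + 1 + ((l + 1) * n + 1 : ℕ) + u : ℝ)) / P := by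
          intro l hl
          refine hblock _ ?_
          have : (0 : ℝ) ≤ ((l + 1) * n + 1 : ℕ) := by positivity
          have : (0 : ℝ) ≤ (r * n : ℕ) := by positivity
          linarith
        have hpos : 0 ≤ n.factorial / P := by positivity
        exact mul_le_mul (mul_le_mul_of_nonneg_left (prod_le_prod (fun _ _ ↦ hpos) h1)
          (by positivity)) (prod_le_prod (fun _ _ ↦ hpos) h2) (prod_nonneg fun _ _ ↦ hpos)
          (mul_nonneg (by positivity) (prod_nonneg fun l hl ↦ hpos.trans (h1 l hl)))

theorem hasSum_shifted_sub (i j : ℕ) :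
    HasSum (fun k : ℕ ↦ 1 / ((k + 1 : ℝ) + j) ^ (i + 1) - 1 / (k + 1 : ℝ) ^ (i + 1))
      (-∑ l ∈ range j, 1 / (l + 1 : ℝ) ^ (i + 1)) := by
  induction j with
  | zero => simp
  | succ j ih =>
    have hstep : HasSum (fun k : ℕ ↦ 1 / ((k + 1 : ℝ) + j) ^ (i + 1)
        - 1 / ((k + 1 : ℝ) + (j + 1 : ℕ)) ^ (i + 1)) (1 / (j + 1 : ℝ) ^ (i + 1)) := by
      rw [hasSum_iff_tendsto_nat_of_nonneg]
      · let g : ℕ → ℝ := fun k ↦ 1 / ((k + 1 : ℝ) + j) ^ (i + 1)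
        have hg : ∀ N, ∑ k ∈ range N, (1 / ((k + 1 : ℝ) + j) ^ (i + 1)
            - 1 / ((k + 1 : ℝ) + (j + 1 : ℕ)) ^ (i + 1)) = g 0 - g N := by
          intro N
          rw [← sum_range_sub' g N]
          refine sum_congr rfl fun k _ ↦ ?_
          simp only [g]
          push_cast
          ring_nf
        simp only [hg]
        have h0 : Filter.Tendsto g Filter.atTop (nhds 0) := by
          have h1 : Filter.Tendsto (fun k : ℕ ↦ 1 / ((k : ℝ) + 1)) Filter.atTop (nhds 0) :=
            tendsto_one_div_add_atTop_nhds_zero_nat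
          refine squeeze_zero (fun k ↦ by positivity) (fun k ↦ ?_) h1
          simp only [g]
          gcongr
          calc (k + 1 : ℝ) ≤ k + 1 + j := by
                have : (0 : ℝ) ≤ j := by positivity
                linarith
            _ ≤ (k + 1 + j) ^ (i + 1) := by
                apply le_self_pow₀ _ (by omega)
                have : (0 : ℝ) ≤ j := by positivity
                have : (0 : ℝ) ≤ k := by positivity
                linarith
        have := h0.const_sub (g 0)
        simpa [g, add_comm] using this
      · intro k
        rw [sub_nonneg]
        gcongr
        omega
    rw [sum_range_succ, neg_add]
    have := ih.sub hstep
    rw [sub_eq_add_neg] at this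
    refine this.congr_fun fun k ↦ ?_
    ring

theorem sum_range_two_mul_add_one (g : ℕ → ℝ) (s : ℕ) :
    ∑ i ∈ range (2 * s + 1), g i = g 0 + ∑ k ∈ range s, (g (2 * k + 1) + g (2 * k + 2)) := by
  induction s with
  | zero => simp
  | succ s ih =>
    rw [sum_range_succ (n := s), ← add_assoc, ← ih,
      show 2 * (s + 1) + 1 = 2 * s + 1 + 1 + 1 by ring,
      sum_range_succ, sum_range_succ]
    ring

namespace HasPartialFractions

theorem exists_symm {n D m : ℕ} {B : ℝ} {f : ℝ → ℝ} (hf : HasPartialFractions n D m B f)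
    (hsymm : ∀ t, f (-n - t) = -f t) :
    ∃ c : ℕ → ℕ → ℝ,
      (∀ t : ℝ, (∀ j ≤ n, t + (j : ℕ) ≠ 0) →
        2 * f t = ∑ i ∈ range m, ∑ j ∈ range (n + 1), c i j / (t + j) ^ (i + 1)) ∧
      (∀ i < m, ∀ j, ∃ z : ℤ, (D : ℝ) ^ (m - 1 - i) * c i j = z) ∧
      ∑ i ∈ range m, ∑ j ∈ range (n + 1), |c i j| ≤ 2 * B ∧
      ∀ i, Odd i → ∑ j ∈ range (n + 1), c i j = 0 := by
  obtain ⟨c, h1, h2, h3⟩ := hf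
  have hreflect : ∀ i, ∑ j ∈ range (n + 1), |c i (n - j)| = ∑ j ∈ range (n + 1), |c i j| :=
    fun i ↦ sum_range_reflect (fun j ↦ |c i j|) (n + 1)
  refine ⟨fun i j ↦ c i j + (-1) ^ i * c i (n - j), fun t ht ↦ ?_, fun i hi j ↦ ?_, ?_,
    fun i hi ↦ ?_⟩
  · have ht' : ∀ j ≤ n, (-n - t) + (j : ℕ) ≠ 0 := by
      intro j hj h
      apply ht (n - j) (by omega)
      rw [Nat.cast_sub hj]
      linarith
    have h4 : f t = -f (-n - t) := by rw [hsymm, neg_neg]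
    rw [two_mul]
    nth_rewrite 2 [h4]
    rw [h1 t ht, h1 _ ht', ← sum_neg_distrib, ← sum_add_distrib]
    refine sum_congr rfl fun i _ ↦ ?_
    simp only [add_div, sum_add_distrib]
    congr 1
    rw [← sum_range_reflect, ← sum_neg_distrib]
    refine sum_congr rfl fun j hj ↦ ?_
    have hj' := Nat.lt_succ_iff.1 (mem_range.1 hj)
    rw [show n + 1 - 1 - j = n - j by omega, Nat.cast_sub hj',
      show (-n - t + (n - j) : ℝ) = -(t + j) by ring, neg_pow (t + j : ℝ), pow_succ (-1 : ℝ)]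
    have h5 : ((-1 : ℝ) ^ i) * (-1) ^ i = 1 := by rw [← mul_pow]; norm_num
    have h6 : ((-1 : ℝ) ^ i) ≠ 0 := by positivity
    have h7 := ht j hj'
    field_simp
    rw [sq, h5, mul_one]
  · obtain ⟨z, hz⟩ := h2 i hi j
    obtain ⟨w, hw⟩ := h2 i hi (n - j)
    refine ⟨z + (-1) ^ i * w, ?_⟩
    push_cast
    rw [← hz, ← hw]
    ring
  · calc _ ≤ ∑ i ∈ range m, ∑ j ∈ range (n + 1), (|c i j| + |c i (n - j)|) := by
          gcongr with i _ j _
          refine (abs_add_le _ _).trans ?_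
          rw [abs_mul, abs_pow, abs_neg, abs_one, one_pow, one_mul]
      _ ≤ 2 * B := by
          simp only [sum_add_distrib, hreflect]
          linarith
  · have h4 : ∑ j ∈ range (n + 1), c i (n - j) = ∑ j ∈ range (n + 1), c i j :=
      sum_range_reflect (fun j ↦ c i j) (n + 1)
    rw [sum_add_distrib, ← mul_sum, h4, hi.neg_one_pow]
    ring

end HasPartialFractions

theorem sum_residues_eq_zero {n m : ℕ} {c : ℕ → ℕ → ℝ} {f : ℕ → ℝ} (hm : 0 < m)
    (hf : ∀ k : ℕ, f k = ∑ i ∈ range m, ∑ j ∈ range (n + 1), c i j / (k + 1 + j : ℝ) ^ (i + 1))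
    (hlim : Filter.Tendsto (fun k : ℕ ↦ (k : ℝ) * f k) Filter.atTop (nhds 0)) :
    ∑ j ∈ range (n + 1), c 0 j = 0 := by
  have h1 : Filter.Tendsto (fun k : ℕ ↦ ∑ i ∈ range m, ∑ j ∈ range (n + 1),
      c i j * ((k : ℝ) / (k + (1 + j : ℝ))) * (1 / (k + (1 + j : ℝ))) ^ i) Filter.atTop
      (nhds (∑ i ∈ range m, ∑ j ∈ range (n + 1), c i j * 1 * 0 ^ i)) := by
    refine tendsto_finsetSum _ fun i _ ↦ tendsto_finsetSum _ fun j _ ↦ ?_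
    refine ((tendsto_natCast_div_add_atTop (1 + j : ℝ)).const_mul _).mul (Filter.Tendsto.pow ?_ _)
    refine tendsto_const_nhds.div_atTop ?_
    exact Filter.tendsto_atTop_add_const_right _ _ tendsto_natCast_atTop_atTop
  have h2 : ∑ i ∈ range m, ∑ j ∈ range (n + 1), c i j * 1 * 0 ^ i
      = ∑ j ∈ range (n + 1), c 0 j := by
    rw [sum_eq_single 0]
    · simp
    · intro i _ hi
      simp [hi]
    · intro h
      exact absurd (mem_range.2 hm) h
  rw [h2] at h1
  refine tendsto_nhds_unique (h1.congr fun k ↦ ?_) hlim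
  rw [hf, mul_sum]
  refine sum_congr rfl fun i _ ↦ ?_
  rw [mul_sum]
  refine sum_congr rfl fun j _ ↦ ?_
  rw [one_div, inv_pow, add_assoc, pow_succ]
  field_simp

/-- Summing an odd partial fraction expansion yields a linear form in odd zeta values. -/
theorem HasPartialFractions.exists_linear_form {n D s : ℕ} {B S : ℝ} {f : ℝ → ℝ}
    (hdvd : ∀ d, 1 ≤ d → d ≤ n → d ∣ D)
    (hf : HasPartialFractions n D (2 * s + 1) B f) (hsymm : ∀ t, f (-n - t) = -f t)
    (hlim : Filter.Tendsto (fun k : ℕ ↦ (k : ℝ) * f (k + 1)) Filter.atTop (nhds 0))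
    (hS : HasSum (fun k : ℕ ↦ f (k + 1)) S) :
    ∃ (P₀ : ℤ) (P : ℕ → ℤ),
      (D : ℝ) ^ (2 * s + 1) * (2 * S) = P₀ + ∑ k ∈ range s, P k * zetaR (2 * (k + 1) + 1) ∧
      ∑ k ∈ range s, |(P k : ℝ)| ≤ (D : ℝ) ^ (2 * s + 1) * (2 * B) := by
  obtain ⟨c, h1, h2, h3, h4⟩ := hf.exists_symm hsymm
  have hrep : ∀ k : ℕ, 2 * f (k + 1) = ∑ i ∈ range (2 * s + 1), ∑ j ∈ range (n + 1),
      c i j / (k + 1 + j : ℝ) ^ (i + 1) := fun k ↦ h1 _ fun j _ ↦ by positivity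
  have hres : ∑ j ∈ range (n + 1), c 0 j = 0 := by
    refine sum_residues_eq_zero (f := fun k : ℕ ↦ 2 * f (k + 1)) (Nat.succ_pos _) hrep ?_
    have := hlim.const_mul 2
    rw [mul_zero] at this
    exact this.congr fun k ↦ by ring
  set σ : ℕ → ℝ := fun i ↦ ∑ j ∈ range (n + 1), c i j with hσ
  set H : ℕ → ℕ → ℝ := fun i j ↦ ∑ l ∈ range j, 1 / (l + 1 : ℝ) ^ (i + 1) with hH
  have hzeta : ∀ i, HasSum (fun k : ℕ ↦ σ i * (1 / (k + 1 : ℝ) ^ (i + 1)))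
      (σ i * zetaR (i + 1)) := by
    intro i
    rcases Nat.eq_zero_or_pos i with rfl | hi
    · simp only [hσ, hres, zero_mul]
      exact hasSum_zero
    · refine HasSum.mul_left _ (Summable.hasSum ?_)
      have := (summable_nat_add_iff 1).2 (Real.summable_one_div_nat_pow.2 (show 1 < i + 1 by omega))
      simpa using this
  have hsum : HasSum (fun k : ℕ ↦ 2 * f (k + 1))
      (∑ i ∈ range (2 * s + 1), (∑ j ∈ range (n + 1), c i j * -H i j + σ i * zetaR (i + 1))) := by
    have := hasSum_sum fun i (_ : i ∈ range (2 * s + 1)) ↦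
      (hasSum_sum fun j (_ : j ∈ range (n + 1)) ↦
        (hasSum_shifted_sub i j).mul_left (c i j)).add (hzeta i)
    refine this.congr_fun fun k ↦ ?_
    rw [hrep]
    refine sum_congr rfl fun i _ ↦ ?_
    rw [hσ, sum_mul, ← sum_add_distrib]
    refine sum_congr rfl fun j _ ↦ ?_
    ring
  have hSeq := (hS.mul_left 2).unique hsum
  have hz_int : ∀ i < 2 * s + 1, ∀ j ≤ n, ∃ z : ℤ, (D : ℝ) ^ (2 * s + 1) * (c i j * -H i j) = z := by
    intro i hi j hj
    obtain ⟨z, hz⟩ := h2 i hi j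
    have h5 : ∀ l ∈ range j, ∃ w : ℤ, (D : ℝ) ^ (i + 1) * (1 / (l + 1 : ℝ) ^ (i + 1)) = w := by
      intro l hl
      obtain ⟨e, he⟩ := hdvd (l + 1) (by omega) (by rw [mem_range] at hl; omega)
      refine ⟨(e : ℤ) ^ (i + 1), ?_⟩
      rw [he]
      push_cast
      field_simp
      rw [mul_pow]
    choose! w hw using h5
    refine ⟨z * -∑ l ∈ range j, w l, ?_⟩
    push_cast
    rw [← sum_congr rfl hw, ← hz, ← mul_sum]
    rw [show 2 * s + 1 = (2 * s + 1 - 1 - i) + (i + 1) by omega, pow_add]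
    simp only [hH, show 2 * s + 1 - 1 - i + (i + 1) - 1 - i = 2 * s + 1 - 1 - i by omega]
    ring
  choose! z hz using hz_int
  have hz_int' : ∀ i < 2 * s + 1, ∃ w : ℤ, (D : ℝ) ^ (2 * s + 1) * σ i = w := by
    intro i hi
    choose w hw using h2 i hi
    refine ⟨(D : ℤ) ^ (i + 1) * ∑ j ∈ range (n + 1), w j, ?_⟩
    push_cast
    rw [← sum_congr rfl fun j _ ↦ hw j, ← mul_sum, ← mul_assoc, ← pow_add,
      show i + 1 + (2 * s + 1 - 1 - i) = 2 * s + 1 by omega]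
  choose! w hw using hz_int'
  refine ⟨∑ i ∈ range (2 * s + 1), ∑ j ∈ range (n + 1), z i j, fun k ↦ w (2 * k + 2), ?_, ?_⟩
  · rw [hSeq, sum_add_distrib, mul_add]
    congr 1
    · push_cast
      rw [mul_sum]
      refine sum_congr rfl fun i hi ↦ ?_
      rw [mul_sum]
      refine sum_congr rfl fun j hj ↦ ?_
      exact hz i (mem_range.1 hi) j (Nat.lt_succ_iff.1 (mem_range.1 hj))
    · rw [sum_range_two_mul_add_one]
      have h0 : σ 0 = 0 := hres
      rw [h0, zero_mul, zero_add, mul_sum]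
      refine sum_congr rfl fun k hk ↦ ?_
      have hodd : σ (2 * k + 1) = 0 := h4 _ ⟨k, rfl⟩
      rw [hodd, zero_mul, zero_add, ← hw (2 * k + 2) (by rw [mem_range] at hk; omega), mul_assoc]
      rfl
  · have h5 : ∑ k ∈ range s, |σ (2 * k + 2)| ≤ 2 * B := by
      calc ∑ k ∈ range s, |σ (2 * k + 2)|
          ≤ |σ 0| + ∑ k ∈ range s, (|σ (2 * k + 1)| + |σ (2 * k + 2)|) := by
            refine le_add_of_nonneg_of_le (abs_nonneg _) ?_
            gcongr
            exact le_add_of_nonneg_left (abs_nonneg _)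
        _ = ∑ i ∈ range (2 * s + 1), |σ i| := (sum_range_two_mul_add_one (fun i ↦ |σ i|) s).symm
        _ ≤ ∑ i ∈ range (2 * s + 1), ∑ j ∈ range (n + 1), |c i j| := by
            gcongr with i _
            exact abs_sum_le_sum_abs _ _
        _ ≤ 2 * B := h3
    calc _ = ∑ k ∈ range s, (D : ℝ) ^ (2 * s + 1) * |σ (2 * k + 2)| := by
          refine sum_congr rfl fun k hk ↦ ?_
          rw [← hw (2 * k + 2) (by rw [mem_range] at hk; omega), abs_mul, abs_pow, Nat.abs_cast]
      _ ≤ _ := by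
          rw [← mul_sum]
          gcongr

theorem Nat.dvd_lcmUpto {d n : ℕ} (h1 : 1 ≤ d) (hn : d ≤ n) : d ∣ n.lcmUpto :=
  dvd_lcm (f := id) (mem_Icc.2 ⟨h1, hn⟩)

theorem Nat.lcmUpto_le_exp_pow (n : ℕ) : (n.lcmUpto : ℝ) ≤ Real.exp (Real.log 4 + 4) ^ n := by
  have hpos : (0 : ℝ) < n.lcmUpto := by exact_mod_cast n.lcmUpto_pos
  rw [← Real.exp_nat_mul, ← Real.log_le_iff_le_exp hpos, ← Chebyshev.psi_eq_log_lcmUpto, mul_comm]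
  exact Chebyshev.psi_le_const_mul_self n.cast_nonneg

theorem hasSum_zetaR_two : HasSum (fun k : ℕ ↦ 1 / (k + 1 : ℝ) ^ 2) (zetaR 2) := by
  have h := (summable_nat_add_iff 1).2 (Real.summable_one_div_nat_pow.2 one_lt_two)
  simpa [zetaR] using h.hasSum

theorem one_le_zetaR_two : 1 ≤ zetaR 2 := by
  simpa using le_hasSum hasSum_zetaR_two 0 fun k _ ↦ by positivity

theorem tendsto_mul_ballRivoal {n r : ℕ} (hr : 1 ≤ r) :
    Filter.Tendsto (fun k : ℕ ↦ (k : ℝ) * ballRivoal n r (k + 1)) Filter.atTop (nhds 0) := by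
  set q : ℝ := ((1 / r) ^ (2 * r ^ 2 + 2 * r + 1) * 3 ^ r) ^ n
  have h : Filter.Tendsto (fun k : ℕ ↦ q * (1 / ((k : ℝ) + 1))) Filter.atTop (nhds 0) := by
    simpa using tendsto_one_div_add_atTop_nhds_zero_nat.const_mul q
  refine squeeze_zero (fun k ↦ mul_nonneg k.cast_nonneg (ballRivoal_bounds hr k).1) (fun k ↦ ?_) h
  calc (k : ℝ) * ballRivoal n r (k + 1) ≤ (k + 1) * (q * (1 / (k + 1 : ℝ) ^ 2)) :=
        mul_le_mul (by linarith) (ballRivoal_bounds hr k).2 (ballRivoal_bounds hr k).1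
          (by positivity)
    _ = q * (1 / ((k : ℝ) + 1)) := by field_simp

/-- The small linear forms in `1, ζ(3), …, ζ(2s+1)`, where `s = r² + 2r`, given by the series
`∑ ballRivoal (2m) r (k + 1)`. -/
theorem exists_small_linear_form {r : ℕ} (hr : 1 ≤ r) (m : ℕ) :
    ∃ (P₀ : ℤ) (P : ℕ → ℤ),
      2 * (1 / (r + 2)) ^ (2 * (r ^ 2 + 2 * r) + 1) *
        (((1 / (6 * (r + 2))) ^ (2 * (r ^ 2 + 2 * r) + 1)) ^ 2) ^ m ≤
        P₀ + ∑ k ∈ range (r ^ 2 + 2 * r), P k * zetaR (2 * (k + 1) + 1) ∧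
      P₀ + ∑ k ∈ range (r ^ 2 + 2 * r), P k * zetaR (2 * (k + 1) + 1) ≤
        2 * zetaR 2 * ((Real.exp (Real.log 4 + 4) ^ (2 * (r ^ 2 + 2 * r) + 1) *
          ((1 / r) ^ (2 * r ^ 2 + 2 * r + 1) * 3 ^ r)) ^ 2) ^ m ∧
      ∑ k ∈ range (r ^ 2 + 2 * r), |(P k : ℝ)| ≤
        2 * (2 * (r ^ 2 + 2 * r) + 1).factorial *
          ((Real.exp (Real.log 4 + 4) ^ (2 * (r ^ 2 + 2 * r) + 1) *
            (2 ^ (2 * (r ^ 2 + 2 * r) + 1) * (3 * (r + 1)) ^ (2 * r))) ^ 2) ^ m := by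
  set C := Real.exp (Real.log 4 + 4)
  set n := 2 * m with hn
  set s := r ^ 2 + 2 * r
  set D := n.lcmUpto
  have hdvd : ∀ d, 1 ≤ d → d ≤ n → d ∣ D := fun d h1 h2 ↦ Nat.dvd_lcmUpto h1 h2
  have hD : (1 : ℝ) ≤ (D : ℝ) ^ (2 * s + 1) :=
    one_le_pow₀ (by exact_mod_cast n.lcmUpto_pos)
  have hDC : (D : ℝ) ^ (2 * s + 1) ≤ (C ^ (2 * s + 1)) ^ n := by
    rw [← pow_mul, mul_comm (2 * s + 1) n, pow_mul]
    exact pow_le_pow_left₀ D.cast_nonneg n.lcmUpto_le_exp_pow _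
  have hZ := hasSum_zetaR_two.mul_left (((1 / r : ℝ) ^ (2 * r ^ 2 + 2 * r + 1) * 3 ^ r) ^ n)
  have hsum : Summable fun k : ℕ ↦ ballRivoal n r (k + 1) :=
    Summable.of_nonneg_of_le (fun k ↦ (ballRivoal_bounds hr k).1)
      (fun k ↦ (ballRivoal_bounds hr k).2) hZ.summable
  obtain ⟨S, hS⟩ := hsum
  have hle := hasSum_le (fun k ↦ (ballRivoal_bounds hr k).2) hS hZ
  have hge := (ballRivoal_ge n r).trans
    (le_hasSum hS (r * n) fun k _ ↦ (ballRivoal_bounds hr k).1)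
  have hS0 : 0 ≤ S := hS.nonneg fun k ↦ (ballRivoal_bounds hr k).1
  obtain ⟨P₀, P, hP, hP'⟩ := HasPartialFractions.exists_linear_form hdvd
    (ballRivoal_hasPartialFractions r n.lcmUpto_ne_zero hdvd)
    (ballRivoal_symm (even_two_mul m) r) (tendsto_mul_ballRivoal hr) hS
  refine ⟨P₀, P, ?_, ?_, ?_⟩
  · rw [← hP, ← pow_mul _ 2 m, ← hn]
    calc _ ≤ 1 * (2 * S) := by linarith
      _ ≤ _ := by gcongr
  · rw [← hP, ← pow_mul _ 2 m, ← hn, mul_pow (C ^ _)]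
    calc _ ≤ (C ^ (2 * s + 1)) ^ n *
          (2 * (((1 / r : ℝ) ^ (2 * r ^ 2 + 2 * r + 1) * 3 ^ r) ^ n * zetaR 2)) := by gcongr
      _ = _ := by ring
  · rw [← pow_mul _ 2 m, ← hn, mul_pow (C ^ _)]
    refine hP'.trans ((mul_le_mul_of_nonneg_right hDC (by positivity)).trans_eq (by ring))

theorem exists_parameter (d : ℕ) {C : ℝ} (hC : 1 ≤ C) : ∃ r : ℕ, 1 ≤ r ∧
    C ^ (2 * (r ^ 2 + 2 * r) + 1) * ((1 / r) ^ (2 * r ^ 2 + 2 * r + 1) * 3 ^ r) < 1 ∧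
    (C ^ (2 * (r ^ 2 + 2 * r) + 1) * ((1 / r) ^ (2 * r ^ 2 + 2 * r + 1) * 3 ^ r) *
      (C ^ (2 * (r ^ 2 + 2 * r) + 1) *
        (2 ^ (2 * (r ^ 2 + 2 * r) + 1) * (3 * (r + 1)) ^ (2 * r))) /
      (1 / (6 * (r + 2))) ^ (2 * (r ^ 2 + 2 * r) + 1)) ^ (d + 1) *
      (C ^ (2 * (r ^ 2 + 2 * r) + 1) * ((1 / r) ^ (2 * r ^ 2 + 2 * r + 1) * 3 ^ r)) ≤ 1 := by
  obtain ⟨r, hr⟩ := exists_nat_gt (6 * C * (2592 * C ^ 2) ^ (d + 1))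
  have hK : 1 ≤ 2592 * C ^ 2 := by nlinarith
  have hK' : 1 ≤ (2592 * C ^ 2) ^ (d + 1) := one_le_pow₀ hK
  have hrC : 6 * C < r := lt_of_le_of_lt (le_mul_of_one_le_right (by positivity) hK') hr
  have hr1 : (1 : ℝ) ≤ r := by linarith
  have hr0 : (0 : ℝ) < r := by linarith
  obtain ⟨a, ha⟩ : ∃ a, a = 2 * (r ^ 2 + 2 * r) + 1 := ⟨_, rfl⟩
  have hra : (r : ℝ) ^ (2 * r) ≤ 2 ^ a := by
    have h : (r : ℝ) ≤ 2 ^ r := by exact_mod_cast r.lt_two_pow_self.le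
    calc (r : ℝ) ^ (2 * r) ≤ (2 ^ r) ^ (2 * r) := by gcongr
      _ = 2 ^ (r * (2 * r)) := (pow_mul _ _ _).symm
      _ ≤ 2 ^ a := pow_le_pow_right₀ one_le_two (by rw [ha]; nlinarith)
  have hα : C ^ a * ((1 / r) ^ (2 * r ^ 2 + 2 * r + 1) * 3 ^ r) ≤ (6 * C / r) ^ a := by
    have h1 : (1 / r : ℝ) ^ (2 * r ^ 2 + 2 * r + 1) = (1 / r) ^ a * r ^ (2 * r) := by
      have : a = 2 * r ^ 2 + 2 * r + 1 + 2 * r := by rw [ha]; ring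
      rw [this, pow_add _ _ (2 * r), mul_assoc, ← mul_pow, one_div_mul_cancel hr0.ne', one_pow,
        mul_one]
    have h3 : (3 : ℝ) ^ r ≤ 3 ^ a := pow_le_pow_right₀ (by norm_num) (by nlinarith)
    calc _ ≤ C ^ a * ((1 / r) ^ a * 2 ^ a * 3 ^ a) := by rw [h1]; gcongr
      _ = (C * (1 / r * 2 * 3)) ^ a := by simp only [mul_pow]
      _ = _ := by congr 1; ring
  have hβ : C ^ a * (2 ^ a * (3 * (r + 1)) ^ (2 * r)) ≤ (24 * C) ^ a := by
    have h6 : (6 : ℝ) ^ (2 * r) ≤ 6 ^ a := pow_le_pow_right₀ (by norm_num) (by nlinarith)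
    calc _ ≤ C ^ a * (2 ^ a * (6 * r) ^ (2 * r)) := by
          have : (3 * (r + 1) : ℝ) ≤ 6 * r := by linarith
          gcongr
      _ ≤ C ^ a * (2 ^ a * (6 ^ a * 2 ^ a)) := by rw [mul_pow]; gcongr
      _ = (C * (2 * (6 * 2))) ^ a := by simp only [mul_pow]
      _ = _ := by congr 1; ring
  have hγ : ((1 / (6 * (r + 2)) : ℝ) ^ a)⁻¹ ≤ (18 * r) ^ a := by
    rw [← inv_pow, one_div, inv_inv]
    have : (6 * (r + 2) : ℝ) ≤ 18 * r := by linarith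
    gcongr
  refine ⟨r, by exact_mod_cast hr1, ?_, ?_⟩
  · rw [← ha]
    refine hα.trans_lt (pow_lt_one₀ (by positivity) ((div_lt_one hr0).2 hrC) (by omega))
  · rw [← ha, div_eq_mul_inv]
    calc _ ≤ ((6 * C / r) ^ a * (24 * C) ^ a * (18 * r) ^ a) ^ (d + 1) * (6 * C / r) ^ a := by
          gcongr
      _ = (6 * C * (2592 * C ^ 2) ^ (d + 1) / r) ^ a := by
          rw [← mul_pow, ← mul_pow, ← pow_mul, mul_comm a, pow_mul, ← mul_pow]
          congr 1
          have : 6 * C / r * (24 * C) * (18 * r) = 2592 * C ^ 2 := by field_simp; norm_num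
          rw [this]
          ring
      _ ≤ 1 := pow_le_one₀ (by positivity) ((div_le_one hr0).2 hr.le)

theorem not_finiteDimensional_of_zetaR_odd_mem (V : Submodule ℚ ℝ)
    (hV : ∀ k : ℕ, 1 ≤ k → zetaR (2 * k + 1) ∈ V) : ¬ FiniteDimensional ℚ V := by
  intro hfin
  obtain ⟨d, η, hη⟩ :=
    Submodule.fg_iff_exists_fin_generating_family.1 (Module.Finite.iff_fg.1 hfin)
  obtain ⟨r, hr, hα, hκ⟩ :=
    exists_parameter d (Real.one_le_exp (add_nonneg (Real.log_nonneg (by norm_num : (1 : ℝ) ≤ 4))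
      zero_le_four))
  have hform := exists_small_linear_form hr
  have hr0 : (0 : ℝ) < r := by exact_mod_cast hr
  set C := Real.exp (Real.log 4 + 4)
  have hC : 0 < C := Real.exp_pos _
  set s := r ^ 2 + 2 * r
  obtain ⟨N, hN, c, hc⟩ := exists_common_denominator (range s)
    (fun k ↦ zetaR (2 * (k + 1) + 1)) d η fun k _ ↦ hη ▸ hV (k + 1) (Nat.succ_pos k)
  have hN1 : (1 : ℝ) ≤ N := by exact_mod_cast hN
  have hZ := one_le_zetaR_two
  set α : ℝ := C ^ (2 * s + 1) * ((1 / r) ^ (2 * r ^ 2 + 2 * r + 1) * 3 ^ r)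
  set β : ℝ := C ^ (2 * s + 1) * (2 ^ (2 * s + 1) * (3 * (r + 1)) ^ (2 * r))
  set γ : ℝ := (1 / (6 * (r + 2))) ^ (2 * s + 1)
  set M : ℝ := 1 + ∑ k ∈ range s, ∑ j, |(c k j : ℝ)| with hM
  have hα0 : 0 < α := by positivity
  have hβ0 : 0 < β := by positivity
  have hγ0 : 0 < γ := by positivity
  have hM0 : 0 < M := by positivity
  refine no_small_linear_forms d η (A := N * (2 * zetaR 2)) (α := α ^ 2) (β := β ^ 2) (γ := γ ^ 2)
    (B := M * (2 * (2 * s + 1).factorial)) (G := N * (2 * (1 / (r + 2)) ^ (2 * s + 1)))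
    (by nlinarith) (by positivity) (by positivity) (by positivity)
    (pow_lt_one₀ hα0.le hα two_ne_zero) (by positivity) (by positivity) ?_ fun m ↦ ?_
  · rw [← mul_pow, ← div_pow, ← pow_mul, mul_comm 2, pow_mul, ← mul_pow]
    exact pow_le_one₀ (by positivity) hκ
  obtain ⟨P₀, P, hlow, hupp, hsum⟩ := hform m
  have heq : ((N * P₀ : ℤ) : ℝ) + ∑ j, ((∑ k ∈ range s, P k * c k j : ℤ) : ℝ) * η j =
      N * (P₀ + ∑ k ∈ range s, P k * zetaR (2 * (k + 1) + 1)) := by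
    push_cast
    rw [mul_add, mul_sum]
    congr 1
    simp only [sum_mul]
    rw [sum_comm]
    refine sum_congr rfl fun k hk ↦ ?_
    rw [mul_left_comm, hc k hk, mul_sum]
    exact sum_congr rfl fun j _ ↦ mul_assoc _ _ _
  refine ⟨N * P₀, fun j ↦ ∑ k ∈ range s, P k * c k j, ?_, ?_, ?_⟩
  · rw [heq, mul_assoc]
    gcongr
  · rw [heq, mul_assoc]
    gcongr
  · calc ∑ j, |((∑ k ∈ range s, P k * c k j : ℤ) : ℝ)|
        ≤ ∑ j, ∑ k ∈ range s, |(P k : ℝ)| * |(c k j : ℝ)| := by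
          gcongr with j
          push_cast
          simpa only [abs_mul] using abs_sum_le_sum_abs (fun k ↦ (P k : ℝ) * c k j) (range s)
      _ = ∑ k ∈ range s, |(P k : ℝ)| * ∑ j, |(c k j : ℝ)| := by
          rw [sum_comm]
          simp only [mul_sum]
      _ ≤ ∑ k ∈ range s, |(P k : ℝ)| * M := by
          gcongr with k hk
          have := single_le_sum (f := fun k ↦ ∑ j, |(c k j : ℝ)|)
            (fun k _ ↦ sum_nonneg fun j _ ↦ abs_nonneg _) hk
          linarith
      _ ≤ _ := by
          rw [← sum_mul, mul_comm, mul_assoc]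
          gcongr

end

/-- (Ball–Rivoal) The ℚ-vector subspace of ℝ spanned by `1, ζ(3), ζ(5), ζ(7), …`
is infinite-dimensional; in particular, `ζ(2k+1)` is irrational for infinitely
many integers `k ≥ 1`. -/
theorem ball_rivoal_infinite_dimension :
    ¬ FiniteDimensional ℚ
        (Submodule.span ℚ
          (({1} : Set ℝ) ∪ {x : ℝ | ∃ k : ℕ, 1 ≤ k ∧ x = zetaR (2 * k + 1)})) ∧
    {k : ℕ | 1 ≤ k ∧ Irrational (zetaR (2 * k + 1))}.Infinite := by
  refine ⟨not_finiteDimensional_of_zetaR_odd_mem _ fun k hk ↦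
    Submodule.subset_span (Or.inr ⟨k, hk, rfl⟩), fun hfin ↦ ?_⟩
  have hS := (hfin.image fun k ↦ zetaR (2 * k + 1)).insert 1
  refine not_finiteDimensional_of_zetaR_odd_mem (Submodule.span ℚ _) (fun k hk ↦ ?_)
    (FiniteDimensional.span_of_finite ℚ hS)
  by_cases hirr : Irrational (zetaR (2 * k + 1))
  · exact Submodule.subset_span (Or.inr ⟨k, ⟨hk, hirr⟩, rfl⟩)
  · obtain ⟨q, hq⟩ := not_not.1 hirr
    rw [← hq, ← mul_one (q : ℝ), ← Rat.smul_def]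
    exact Submodule.smul_mem _ q (Submodule.subset_span (Or.inl rfl))
end
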